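/- arXiv:1107.1094 — 2 statements merged into one kernel-verified Lean document; each statement's English description precedes it below -/
import Mathlib

section
/- Let ν be a probability measure on ℝ with compact support and let μ = ν^ℤ be the product measure on Ω = ℝ^ℤ. Fix E ∈ ℝ and for x ∈ ℝ let A_E(x) be the SL(2,ℝ) matrix with rows (E - x, -1) and (1, 0), and for ω ∈ Ω and n ≥ 1 set M_{E,ω}(n) = A_E(ω_n) · A_E(ω_{n-1}) ⋯ A_E(ω_1). Then there exists a real number γ(E) ≥ 0 such that for μ-almost every ω ∈ Ω, (1/n) log ‖M_{E,ω}(n)‖ → γ(E) as n → ∞. -/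
open MeasureTheory Filter

noncomputable section

/-- The operator (Euclidean) norm of a real 2×2 matrix. -/
def opNorm (M : Matrix (Fin 2) (Fin 2) ℝ) : ℝ := ‖Matrix.toEuclideanCLM (𝕜 := ℝ) M‖

/-- The one-step transfer matrix `A_E(x)` of the discrete Schrödinger equation. -/
def AE (E x : ℝ) : Matrix (Fin 2) (Fin 2) ℝ := !![E - x, -1; 1, 0]

/-- The `n`-step transfer matrix `M_{E,ω}(n) = A_E(ω_n) ⋯ A_E(ω_1)`. -/
def transferZ (E : ℝ) (ω : ℤ → ℝ) : ℕ → Matrix (Fin 2) (Fin 2) ℝ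
  | 0 => 1
  | n + 1 => AE E (ω (n + 1)) * transferZ E ω n

/-- The topological support of a measure. -/
def msupp {X : Type*} [TopologicalSpace X] [MeasurableSpace X] (ν : Measure X) : Set X :=
  {x | ∀ U ∈ nhds x, ν U ≠ 0}

open scoped Topology

/-- The Euclidean operator norm is continuous in the matrix. -/
lemma continuous_opNorm : Continuous opNorm := by
  have h : Continuous (fun M : Matrix (Fin 2) (Fin 2) ℝ => Matrix.toEuclideanCLM (𝕜 := ℝ) M) :=
    LinearMap.continuous_of_finiteDimensional
      ((Matrix.toEuclideanCLM (n := Fin 2) (𝕜 := ℝ)).toAlgEquiv.toLinearMap)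
  exact h.norm

lemma opNorm_mul_le (A B : Matrix (Fin 2) (Fin 2) ℝ) :
    opNorm (A * B) ≤ opNorm A * opNorm B := by
  unfold opNorm
  rw [map_mul]
  exact norm_mul_le _ _

lemma one_le_opNorm (A : Matrix (Fin 2) (Fin 2) ℝ) (h : A.det = 1) : 1 ≤ opNorm A := by
  have key : ∀ j : Fin 2, A 0 j ^ 2 + A 1 j ^ 2 ≤ opNorm A ^ 2 := by
    intro j
    have h1 := (Matrix.toEuclideanCLM (𝕜 := ℝ) A).le_opNorm (EuclideanSpace.single j 1)
    have h2 : ‖Matrix.toEuclideanCLM (𝕜 := ℝ) A (EuclideanSpace.single j 1)‖ ^ 2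
        = A 0 j ^ 2 + A 1 j ^ 2 := by
      rw [EuclideanSpace.norm_sq_eq]
      simp [Matrix.ofLp_toEuclideanCLM]
    rw [← h2]
    have h3 : ‖(EuclideanSpace.single j (1:ℝ) : EuclideanSpace ℝ (Fin 2))‖ = 1 := by simp
    rw [h3, mul_one] at h1
    exact pow_le_pow_left₀ (norm_nonneg _) h1 2
  have k0 := key 0
  have k1 := key 1
  rw [Matrix.det_fin_two] at h
  have h0 : 0 ≤ opNorm A := norm_nonneg _
  nlinarith [sq_nonneg (A 0 0 - A 1 1), sq_nonneg (A 0 1 + A 1 0)]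

lemma det_transferZ (E : ℝ) (ω : ℤ → ℝ) (n : ℕ) : (transferZ E ω n).det = 1 := by
  induction n with
  | zero => simp [transferZ]
  | succ n ih => rw [transferZ, Matrix.det_mul, ih]; simp [AE, Matrix.det_fin_two]

/-- The shift by `m`. -/
def shiftZ (m : ℕ) (ω : ℤ → ℝ) : ℤ → ℝ := fun i => ω (i + m)

/-- The shift by `m`, forgetting the nonpositive coordinates. -/
def shiftP (m : ℕ) (ω : ℤ → ℝ) : ℤ → ℝ := fun i => if 1 ≤ i then ω (i + m) else 0

lemma shiftZ_shiftZ (m n : ℕ) (ω : ℤ → ℝ) : shiftZ n (shiftZ m ω) = shiftZ (m + n) ω := by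
  funext i; simp only [shiftZ]; congr 1; push_cast; ring

lemma shiftZ_zero (ω : ℤ → ℝ) : shiftZ 0 ω = ω := by
  funext i; simp [shiftZ]

lemma transferZ_congr (E : ℝ) (ω ω' : ℤ → ℝ) (n : ℕ)
    (h : ∀ i : ℤ, 1 ≤ i → i ≤ n → ω i = ω' i) : transferZ E ω n = transferZ E ω' n := by
  induction n with
  | zero => rfl
  | succ n ih =>
    rw [transferZ, transferZ, ih (fun i h1 h2 => h i h1 (by push_cast; omega)),
      h (n + 1) (by omega) (by push_cast; omega)]

lemma transferZ_add (E : ℝ) (ω : ℤ → ℝ) (m n : ℕ) :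
    transferZ E ω (m + n) = transferZ E (shiftZ m ω) n * transferZ E ω m := by
  induction n with
  | zero => simp [transferZ]
  | succ n ih =>
    rw [← add_assoc, transferZ, transferZ, ih, Matrix.mul_assoc]
    congr 2
    simp only [shiftZ]; congr 1; push_cast; ring

lemma continuous_transferZ (E : ℝ) (n : ℕ) : Continuous (fun ω => transferZ E ω n) := by
  induction n with
  | zero => exact continuous_const
  | succ n ih =>
    have h : Continuous (fun ω : ℤ → ℝ => AE E (ω (n + 1))) := by
      refine continuous_matrix fun i j => ?_
      fin_cases i <;> fin_cases j <;> simp [AE] <;> fun_prop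
    exact h.matrix_mul ih

/-- The logarithm of the norm of the transfer matrix. -/
def LX (E : ℝ) (n : ℕ) (ω : ℤ → ℝ) : ℝ := Real.log (opNorm (transferZ E ω n))

lemma opNorm_transferZ_ge (E : ℝ) (ω : ℤ → ℝ) (n : ℕ) : 1 ≤ opNorm (transferZ E ω n) :=
  one_le_opNorm _ (det_transferZ E ω n)

lemma LX_nonneg (E : ℝ) (n : ℕ) (ω : ℤ → ℝ) : 0 ≤ LX E n ω :=
  Real.log_nonneg (opNorm_transferZ_ge E ω n)

lemma continuous_LX (E : ℝ) (n : ℕ) : Continuous (LX E n) :=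
  (continuous_opNorm.comp (continuous_transferZ E n)).log
    (fun ω => (zero_lt_one.trans_le (opNorm_transferZ_ge E ω n)).ne')

lemma LX_zero (E : ℝ) (ω : ℤ → ℝ) : LX E 0 ω = 0 := by
  simp [LX, transferZ, opNorm]

lemma LX_add_le (E : ℝ) (m n : ℕ) (ω : ℤ → ℝ) :
    LX E (m + n) ω ≤ LX E m ω + LX E n (shiftZ m ω) := by
  have h1 := opNorm_transferZ_ge E ω (m + n)
  have h2 := opNorm_transferZ_ge E ω m
  have h3 := opNorm_transferZ_ge E (shiftZ m ω) n
  unfold LX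
  rw [add_comm (Real.log _), ← Real.log_mul (by linarith) (by linarith)]
  apply Real.log_le_log (by linarith)
  rw [transferZ_add]
  exact opNorm_mul_le _ _

lemma LX_shift_le (E : ℝ) (m : ℕ) (ω : ℤ → ℝ) :
    ∃ c : ℝ, ∀ n, LX E n (shiftZ m ω) ≤ LX E (m + n) ω + c := by
  have hd := det_transferZ E ω m
  have hu : IsUnit (transferZ E ω m).det := by rw [hd]; exact isUnit_one
  have hdi : ((transferZ E ω m)⁻¹).det = 1 := by
    rw [Matrix.det_nonsing_inv, hd]; simp
  refine ⟨Real.log (opNorm ((transferZ E ω m)⁻¹)), fun n => ?_⟩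
  have h1 := opNorm_transferZ_ge E ω (m + n)
  have h2 := one_le_opNorm _ hdi
  have h3 := opNorm_transferZ_ge E (shiftZ m ω) n
  unfold LX
  rw [← Real.log_mul (by linarith) (by linarith)]
  apply Real.log_le_log (by linarith)
  have : transferZ E (shiftZ m ω) n = transferZ E ω (m + n) * (transferZ E ω m)⁻¹ := by
    rw [transferZ_add, Matrix.mul_assoc, Matrix.mul_nonsing_inv _ hu, Matrix.mul_one]
  rw [this]
  exact opNorm_mul_le _ _

lemma LX_shiftP (E : ℝ) (n m : ℕ) (ω : ℤ → ℝ) : LX E n (shiftP m ω) = LX E n (shiftZ m ω) := by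
  unfold LX
  rw [transferZ_congr E (shiftP m ω) (shiftZ m ω) n]
  intro i h1 _
  simp [shiftP, shiftZ, h1]

/-- The good set: uniformly bounded one step growth. -/
def goodSet (E C : ℝ) : Set (ℤ → ℝ) := {ω | ∀ m : ℕ, LX E 1 (shiftZ m ω) ≤ C}

lemma goodSet_shift {E C : ℝ} {ω : ℤ → ℝ} (h : ω ∈ goodSet E C) (m : ℕ) :
    shiftZ m ω ∈ goodSet E C := fun n => by rw [shiftZ_shiftZ]; exact h _

lemma LX_le_good {E C : ℝ} {ω : ℤ → ℝ} (h : ω ∈ goodSet E C) (n : ℕ) : LX E n ω ≤ C * n := by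
  induction n with
  | zero => simp [LX_zero]
  | succ n ih =>
    have := LX_add_le E n 1 ω
    have := h n
    push_cast
    linarith

/-- Upper bound by blocks. -/
lemma LX_block_le {E : ℝ} {ω : ℤ → ℝ} (k m : ℕ) :
    LX E (k * m) ω ≤ ∑ j ∈ Finset.range m, LX E k (shiftZ (k * j) ω) := by
  induction m with
  | zero => simp [LX_zero]
  | succ m ih =>
    rw [Finset.sum_range_succ, mul_add, mul_one]
    have := LX_add_le E (k * m) k ω
    linarith

/-- The bad set: no good return before time `N`. -/
def badSet (E a : ℝ) (N : ℕ) : Set (ℤ → ℝ) := {ω | ∀ n : ℕ, 1 ≤ n → n ≤ N → a * n < LX E n ω}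

open Classical in
/-- The Katznelson-Weiss covering estimate. -/
lemma LX_cover {E C a : ℝ} (ha : 0 ≤ a) (hC : 0 ≤ C) (N : ℕ) (L : ℕ) :
    ∀ ω ∈ goodSet E C, LX E L ω ≤ a * L + C * N +
      ∑ i ∈ Finset.range L, (badSet E a N).indicator (fun _ => C) (shiftZ i ω) := by
  induction L using Nat.strong_induction_on with
  | _ L ih =>
  intro ω hω
  have hnn : ∀ (ω' : ℤ → ℝ), 0 ≤ (badSet E a N).indicator (fun _ => C) ω' :=
    fun ω' => Set.indicator_nonneg (fun _ _ => hC) ω'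
  rcases le_or_gt L N with hLN | hLN
  · have h1 := LX_le_good hω L
    have h2 : (L : ℝ) ≤ N := by exact_mod_cast hLN
    have h3 : C * L ≤ C * N := mul_le_mul_of_nonneg_left h2 hC
    have h4 : 0 ≤ a * (L : ℝ) := by positivity
    have h5 := Finset.sum_nonneg (s := Finset.range L) (fun i _ => hnn (shiftZ i ω))
    linarith
  · -- general step: remove a first block of length `n`
    have step : ∀ n : ℕ, 1 ≤ n → n ≤ L →
        LX E n ω ≤ a * n + ∑ i ∈ Finset.range n, (badSet E a N).indicator (fun _ => C) (shiftZ i ω) →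
        LX E L ω ≤ a * L + C * N +
      ∑ i ∈ Finset.range L, (badSet E a N).indicator (fun _ => C) (shiftZ i ω) := by
      intro n h1 h2 h3
      obtain ⟨r, rfl⟩ := Nat.exists_eq_add_of_le h2
      have h4 := ih r (by omega) _ (goodSet_shift hω n)
      have h5 := LX_add_le E n r ω
      rw [Finset.sum_range_add]
      simp only [shiftZ_shiftZ] at h4
      push_cast
      linarith
    by_cases hb : ω ∈ badSet E a N
    · refine step 1 le_rfl (by omega) ?_
      have := hω 0
      rw [shiftZ_zero] at this
      simp [shiftZ_zero, hb]
      linarith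
    · simp only [badSet, Set.mem_ofPred_eq, not_forall, not_lt] at hb
      obtain ⟨n, h1, h2, h3⟩ := hb
      refine step n h1 (by omega) ?_
      have h5 := Finset.sum_nonneg (s := Finset.range n) (fun i _ => hnn (shiftZ i ω))
      linarith

/-- The tail event that the lower growth rate is `< a`. -/
def lowSet (E a : ℝ) : Set (ℤ → ℝ) :=
  {ω | ∃ q : ℚ, (q : ℝ) < a ∧ ∃ᶠ n : ℕ in atTop, LX E n ω ≤ q * n}

lemma freq_aux (u v : ℕ → ℝ) (c : ℝ) (a : ℝ) (m : ℕ) (h : ∀ n, u n ≤ v (m + n) + c)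
    (hv : ∃ q : ℚ, (q : ℝ) < a ∧ ∃ᶠ n : ℕ in atTop, v n ≤ q * n) :
    ∃ q : ℚ, (q : ℝ) < a ∧ ∃ᶠ n : ℕ in atTop, u n ≤ q * n := by
  obtain ⟨q, hq, hf⟩ := hv
  obtain ⟨q', h1, h2⟩ := exists_rat_btwn hq
  refine ⟨q', h2, ?_⟩
  have hpos : (0 : ℝ) < q' - q := by linarith
  obtain ⟨N, hN⟩ := exists_nat_gt ((q * m + c) / ((q' : ℝ) - q))
  rw [frequently_atTop] at hf ⊢
  intro A
  obtain ⟨b, hb, hv⟩ := hf (m + (A + N))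
  obtain ⟨r, rfl⟩ := Nat.exists_eq_add_of_le (show m ≤ b by omega)
  refine ⟨r, by omega, (h r).trans ?_⟩
  have hr : (N : ℝ) ≤ r := by exact_mod_cast (show N ≤ r by omega)
  rw [div_lt_iff₀ hpos] at hN
  push_cast at hv
  nlinarith

lemma freq_aux' (u v : ℕ → ℝ) (c : ℝ) (a : ℝ) (m : ℕ) (h : ∀ n, v (m + n) ≤ u n + c)
    (hv : ∃ q : ℚ, (q : ℝ) < a ∧ ∃ᶠ n : ℕ in atTop, u n ≤ q * n) :
    ∃ q : ℚ, (q : ℝ) < a ∧ ∃ᶠ n : ℕ in atTop, v n ≤ q * n := by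
  obtain ⟨q, hq, hf⟩ := hv
  obtain ⟨q', h1, h2⟩ := exists_rat_btwn hq
  refine ⟨q', h2, ?_⟩
  have hpos : (0 : ℝ) < q' - q := by linarith
  obtain ⟨N, hN⟩ := exists_nat_gt ((c - q' * m) / ((q' : ℝ) - q))
  rw [frequently_atTop] at hf ⊢
  intro A
  obtain ⟨r, hb, hv⟩ := hf (A + N)
  refine ⟨m + r, by omega, (h r).trans ?_⟩
  have hr : (N : ℝ) ≤ r := by exact_mod_cast (show N ≤ r by omega)
  rw [div_lt_iff₀ hpos] at hN
  push_cast
  nlinarith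

lemma lowSet_shiftP (E a : ℝ) (m : ℕ) : shiftP m ⁻¹' lowSet E a = lowSet E a := by
  ext ω
  simp only [lowSet, Set.mem_preimage, Set.mem_ofPred_eq, LX_shiftP]
  constructor
  · refine freq_aux' (fun n => LX E n (shiftZ m ω)) (fun n => LX E n ω) (LX E m ω) a m ?_
    intro n
    have := LX_add_le E m n ω
    linarith
  · obtain ⟨c, hc⟩ := LX_shift_le E m ω
    exact freq_aux (fun n => LX E n (shiftZ m ω)) (fun n => LX E n ω) c a m hc

lemma measurable_LX (E : ℝ) (n : ℕ) : Measurable (LX E n) := (continuous_LX E n).measurable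

lemma measurableSet_lowSet (E a : ℝ) : MeasurableSet (lowSet E a) := by
  have : lowSet E a = ⋃ q : ℚ, ⋃ _ : (q : ℝ) < a, ⋂ N : ℕ, ⋃ n : ℕ, ⋃ _ : N ≤ n,
      {ω | LX E n ω ≤ q * n} := by
    ext ω
    simp [lowSet, frequently_atTop]
  rw [this]
  refine MeasurableSet.iUnion fun q => MeasurableSet.iUnion fun _ => MeasurableSet.iInter fun N =>
    MeasurableSet.iUnion fun n => MeasurableSet.iUnion fun _ => ?_
  exact measurableSet_le (measurable_LX E n) measurable_const

lemma measurableSet_badSet (E a : ℝ) (N : ℕ) : MeasurableSet (badSet E a N) := by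
  have : badSet E a N = ⋂ n : ℕ, ⋂ _ : 1 ≤ n, ⋂ _ : n ≤ N, {ω | a * n < LX E n ω} := by
    ext ω
    simp [badSet]
  rw [this]
  refine MeasurableSet.iInter fun n => MeasurableSet.iInter fun _ => MeasurableSet.iInter fun _ => ?_
  exact measurableSet_lt measurable_const (measurable_LX E n)

lemma measurable_shiftZ (m : ℕ) : Measurable (shiftZ m) :=
  measurable_pi_iff.2 fun _ => measurable_pi_apply _

lemma tail_lowSet (E a : ℝ) :
    MeasurableSet[limsup (fun n : ℕ => MeasurableSpace.comap (fun ω : ℤ → ℝ => ω (n + 1))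
      inferInstance) atTop] (lowSet E a) := by
  rw [limsup_eq_iInf_iSup_of_nat, MeasurableSpace.measurableSet_iInf]
  intro m
  rw [← lowSet_shiftP E a m]
  have hm : @Measurable _ _ (⨆ i ≥ m, MeasurableSpace.comap (fun ω : ℤ → ℝ => ω ((i : ℕ) + 1))
      inferInstance) _ (shiftP m) := by
    rw [@measurable_pi_iff]
    intro i
    by_cases hi : 1 ≤ i
    · simp only [shiftP, hi, if_true]
      obtain ⟨j, hj⟩ := Int.eq_ofNat_of_zero_le (show 0 ≤ i - 1 by omega)
      obtain rfl : i = (j : ℤ) + 1 := by omega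
      have h1 : Measurable[MeasurableSpace.comap (fun ω : ℤ → ℝ => ω (((j + m : ℕ) : ℤ) + 1))
        inferInstance] (fun ω : ℤ → ℝ => ω ((j : ℤ) + 1 + m)) := by
        have : (fun ω : ℤ → ℝ => ω ((j : ℤ) + 1 + m))
          = (fun ω : ℤ → ℝ => ω (((j + m : ℕ) : ℤ) + 1)) := by
          funext ω; congr 1; push_cast; ring
        rw [this]
        exact comap_measurable _
      exact h1.mono (le_iSup₂_of_le (j + m) (by omega) le_rfl) le_rfl
    · simp only [shiftP, hi, if_false]
      exact measurable_const
  exact hm (measurableSet_lowSet E a)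

/-- The lower bound: the covering argument. -/
lemma lowSet_null (E C a γ : ℝ) (μ : Measure (ℤ → ℝ)) [IsProbabilityMeasure μ] (hC : 0 ≤ C)
    (hgood : ∀ᵐ ω ∂μ, ω ∈ goodSet E C)
    (hshift : ∀ m, MeasurePreserving (shiftZ m) μ μ)
    (hind : ProbabilityTheory.iIndep (fun n : ℕ => MeasurableSpace.comap
      (fun ω : ℤ → ℝ => ω (n + 1)) inferInstance) μ)
    (hLXint : ∀ n, Integrable (LX E n) μ)
    (hγ : ∀ L : ℕ, 1 ≤ L → γ * L ≤ ∫ ω, LX E L ω ∂μ) (ha : a < γ) :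
    μ (lowSet E a) = 0 := by
  have h01 := ProbabilityTheory.measure_zero_or_one_of_measurableSet_limsup_atTop
    (s := fun n : ℕ => MeasurableSpace.comap (fun ω : ℤ → ℝ => ω (n + 1)) inferInstance)
    (fun n => (measurable_pi_apply ((n : ℤ) + 1)).comap_le) hind (tail_lowSet E a)
  rcases h01 with h | h
  · exact h
  exfalso
  have hae : ∀ᵐ ω ∂μ, ω ∈ lowSet E a := by
    rw [← prob_compl_eq_zero_iff (measurableSet_lowSet E a)] at h
    exact h
  have hex : ∀ ω ∈ lowSet E a, ∃ n : ℕ, 1 ≤ n ∧ LX E n ω ≤ a * n := by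
    rintro ω ⟨q, hq, hf⟩
    obtain ⟨n, hn, h1⟩ := (frequently_atTop.1 hf) 1
    refine ⟨n, hn, h1.trans ?_⟩
    have : (0 : ℝ) ≤ n := Nat.cast_nonneg n
    nlinarith
  have ha0 : 0 ≤ a := by
    obtain ⟨ω, hω⟩ := hae.exists
    obtain ⟨n, hn, h1⟩ := hex ω hω
    have h2 := LX_nonneg E n ω
    have : (0 : ℝ) < n := by exact_mod_cast hn
    by_contra hneg
    nlinarith
  have hnull : μ (⋂ N, badSet E a N) = 0 := by
    refine measure_mono_null ?_ hae
    intro ω hω hω'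
    obtain ⟨n, hn, h1⟩ := hex ω hω'
    have := Set.mem_iInter.1 hω n n hn le_rfl
    linarith
  have hanti : Antitone (badSet E a) := fun N N' h ω hω n h1 h2 => hω n h1 (h2.trans h)
  have hlim := tendsto_measure_iInter_atTop (μ := μ)
    (fun N => (measurableSet_badSet E a N).nullMeasurableSet) hanti ⟨0, measure_ne_top _ _⟩
  rw [hnull] at hlim
  have hlim' : Tendsto (fun N => μ.real (badSet E a N)) atTop (𝓝 0) :=
    (ENNReal.tendsto_toReal ENNReal.zero_ne_top).comp hlim
  have hmain : ∀ N : ℕ, γ ≤ a + C * μ.real (badSet E a N) := by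
    intro N
    have hindint : Integrable ((badSet E a N).indicator (fun _ => C)) μ :=
      (integrable_const C).indicator (measurableSet_badSet E a N)
    have hterm : ∀ i, Integrable (fun ω => (badSet E a N).indicator (fun _ => C) (shiftZ i ω)) μ :=
      fun i => (hshift i).integrable_comp_of_integrable hindint
    have hval : ∀ i, ∫ ω, (badSet E a N).indicator (fun _ => C) (shiftZ i ω) ∂μ
        = C * μ.real (badSet E a N) := by
      intro i
      rw [← integral_map (φ := shiftZ i) (f := (badSet E a N).indicator (fun _ => C))
        (measurable_shiftZ i).aemeasurable
        (by rw [(hshift i).map_eq]; exact hindint.aestronglyMeasurable), (hshift i).map_eq,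
        integral_indicator (measurableSet_badSet E a N)]
      simp [mul_comm]
    have hL : ∀ L : ℕ, 1 ≤ L → (γ - a - C * μ.real (badSet E a N)) * L ≤ C * N := by
      intro L hL
      have h1 := hγ L hL
      have h2 : ∫ ω, LX E L ω ∂μ ≤ ∫ ω, (a * L + C * N +
          ∑ i ∈ Finset.range L, (badSet E a N).indicator (fun _ => C) (shiftZ i ω)) ∂μ := by
        refine integral_mono_ae (hLXint L) ?_ ?_
        · exact (integrable_const _).add (integrable_finsetSum _ fun i _ => hterm i)
        · filter_upwards [hgood] with ω hω
          exact LX_cover ha0 hC N L ω hω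
      rw [integral_add (integrable_const _) (integrable_finsetSum _ fun i _ => hterm i),
        integral_finsetSum _ (fun i _ => hterm i)] at h2
      simp only [hval, integral_const, Finset.sum_const, Finset.card_range, probReal_univ,
        smul_eq_mul, one_mul, nsmul_eq_mul] at h2
      nlinarith
    by_contra hcon
    push Not at hcon
    have hpos : 0 < γ - a - C * μ.real (badSet E a N) := by linarith
    obtain ⟨L, hLL⟩ := exists_nat_gt (C * N / (γ - a - C * μ.real (badSet E a N)))
    rw [div_lt_iff₀ hpos] at hLL
    have := hL (L + 1) (by omega)
    push_cast at this
    nlinarith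
  have hlim2 : Tendsto (fun N => a + C * μ.real (badSet E a N)) atTop (𝓝 (a + C * 0)) :=
    (hlim'.const_mul C).const_add a
  have := ge_of_tendsto' hlim2 hmain
  linarith

/-- Independence of disjoint blocks. -/
lemma block_indep (E : ℝ) (μ : Measure (ℤ → ℝ)) [IsProbabilityMeasure μ]
    (hind : ProbabilityTheory.iIndepFun (fun (i : ℤ) (ω : ℤ → ℝ) => ω i) μ) (k i j : ℕ)
    (hij : i < j) :
    ProbabilityTheory.IndepFun (fun ω => LX E k (shiftZ (k * i) ω))
      (fun ω => LX E k (shiftZ (k * j) ω)) μ := by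
  classical
  -- extend by zero a function on a finite set, then evaluate
  let F : (l : ℕ) → ((Finset.Ioc (k * l : ℤ) (k * l + k) : Finset ℤ) → ℝ) → ℝ := fun l x =>
    LX E k (fun p => if hp : p + (k * l : ℕ) ∈ Finset.Ioc (k * l : ℤ) (k * l + k)
      then x ⟨p + (k * l : ℕ), hp⟩ else 0)
  have hF : ∀ l, Measurable (F l) := by
    intro l
    refine (measurable_LX E k).comp (measurable_pi_iff.2 fun p => ?_)
    split_ifs with hp
    · exact measurable_pi_apply _
    · exact measurable_const
  have hFe : ∀ l, (fun ω => LX E k (shiftZ (k * l) ω)) = F l ∘ fun ω p => ω p := by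
    intro l
    funext ω
    simp only [F, Function.comp, LX]
    rw [transferZ_congr E (shiftZ (k * l) ω)]
    intro p h1 h2
    have : p + (k * l : ℕ) ∈ Finset.Ioc (k * l : ℤ) (k * l + k) := by
      rw [Finset.mem_Ioc]; push_cast; constructor <;> linarith
    rw [dif_pos this]
    rfl
  have hdisj : Disjoint (Finset.Ioc (k * i : ℤ) (k * i + k)) (Finset.Ioc (k * j : ℤ) (k * j + k)) := by
    rw [Finset.disjoint_left]
    intro p h1 h2
    rw [Finset.mem_Ioc] at h1 h2
    have h3 : (i : ℤ) + 1 ≤ j := by exact_mod_cast hij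
    have h4 : (0 : ℤ) ≤ k := by positivity
    nlinarith
  rw [hFe i, hFe j]
  exact (hind.indepFun_finset _ _ hdisj (fun p => measurable_pi_apply p)).comp (hF i) (hF j)

/-- The upper bound. -/
lemma upper_bound (E C a : ℝ) (k : ℕ) (hk : 1 ≤ k) (μ : Measure (ℤ → ℝ)) [IsProbabilityMeasure μ]
    (hC : 0 ≤ C) (hgood : ∀ᵐ ω ∂μ, ω ∈ goodSet E C)
    (hshift : ∀ m, MeasurePreserving (shiftZ m) μ μ)
    (hind : ProbabilityTheory.iIndepFun (fun (i : ℤ) (ω : ℤ → ℝ) => ω i) μ)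
    (hLXint : ∀ n, Integrable (LX E n) μ) (ha : ∫ ω, LX E k ω ∂μ < a * k) :
    ∀ᵐ ω ∂μ, ∀ᶠ n : ℕ in atTop, LX E n ω ≤ a * n + C * k := by
  have hk0 : (0 : ℝ) < k := by exact_mod_cast hk
  have ha0 : 0 ≤ a := by
    have : 0 ≤ ∫ ω, LX E k ω ∂μ := integral_nonneg fun ω => LX_nonneg E k ω
    by_contra hneg
    nlinarith
  have hsl := ProbabilityTheory.strong_law_ae_real (μ := μ)
    (fun j ω => LX E k (shiftZ (k * j) ω)) (by simpa [shiftZ_zero] using hLXint k)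
    (by
      intro i j hij
      rcases lt_or_gt_of_ne hij with h | h
      · exact block_indep E μ hind k i j h
      · exact (block_indep E μ hind k j i h).symm)
    (by
      intro j
      have : ProbabilityTheory.IdentDistrib (shiftZ (k * j)) (shiftZ (k * 0)) μ μ :=
        ⟨(measurable_shiftZ _).aemeasurable, (measurable_shiftZ _).aemeasurable, by
          rw [(hshift _).map_eq, (hshift _).map_eq]⟩
      exact this.comp (measurable_LX E k))
  filter_upwards [hsl, hgood] with ω hω hg
  simp only [mul_zero, shiftZ_zero] at hω
  have hev := (hω.eventually_lt_const ha).and (eventually_ge_atTop 1)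
  have hdiv : Tendsto (fun n : ℕ => n / k) atTop atTop :=
    Nat.tendsto_div_const_atTop (by omega)
  filter_upwards [hdiv.eventually hev] with n hn
  obtain ⟨hn1, hn2⟩ := hn
  have hm0 : (0 : ℝ) < ((n / k : ℕ) : ℝ) := by exact_mod_cast hn2
  rw [div_lt_iff₀ hm0] at hn1
  have e : k * (n / k) + n % k = n := Nat.div_add_mod n k
  have h1 := LX_add_le E (k * (n / k)) (n % k) ω
  rw [e] at h1
  have h2 := LX_le_good (goodSet_shift hg (k * (n / k))) (n % k)
  have h3 := LX_block_le (E := E) (ω := ω) k (n / k)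
  have h4 : ((n % k : ℕ) : ℝ) ≤ k := by exact_mod_cast (Nat.mod_lt n (by omega)).le
  have h5 : C * ((n % k : ℕ) : ℝ) ≤ C * k := mul_le_mul_of_nonneg_left h4 hC
  have h6 : (k : ℝ) * ((n / k : ℕ) : ℝ) ≤ n := by
    exact_mod_cast (show k * (n / k) ≤ n by omega)
  have h7 : a * ((k : ℝ) * ((n / k : ℕ) : ℝ)) ≤ a * n := mul_le_mul_of_nonneg_left h6 ha0
  linarith

lemma ae_msupp (ν : Measure ℝ) : ∀ᵐ x ∂ν, x ∈ msupp ν := by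
  change ν (msupp ν)ᶜ = 0
  refine measure_null_of_locally_null _ fun x hx => ?_
  simp only [msupp, Set.mem_compl_iff, Set.mem_ofPred_eq, not_forall, not_not] at hx
  obtain ⟨U, hU, h0⟩ := hx
  exact ⟨U, mem_nhdsWithin_of_mem_nhds hU, h0⟩

/-- **Existence of the Lyapunov exponent.** Let `ν` be a compactly supported probability
measure on `ℝ` and `μ = ν^ℤ` the product measure on `Ω = ℝ^ℤ` (characterized by its values
on cylinder sets). Fix `E ∈ ℝ`. Then there is `γ(E) ≥ 0` such that for `μ`-almost every `ω`,
`(1/n) log ‖M_{E,ω}(n)‖ → γ(E)` as `n → ∞`. -/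
theorem lyapunov_exponent_exists
    (ν : Measure ℝ) [IsProbabilityMeasure ν]
    (hsupp_compact : IsCompact (msupp ν))
    (μ : Measure (ℤ → ℝ)) [IsProbabilityMeasure μ]
    (hμ : ∀ (s : Finset ℤ) (A : ℤ → Set ℝ), (∀ i, MeasurableSet (A i)) →
      μ {ω | ∀ i ∈ s, ω i ∈ A i} = ∏ i ∈ s, ν (A i))
    (E : ℝ) :
    ∃ γ : ℝ, 0 ≤ γ ∧
      ∀ᵐ ω ∂μ, Tendsto (fun n : ℕ => (1 / (n : ℝ)) * Real.log (opNorm (transferZ E ω n)))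
        atTop (nhds γ) := by
  have hpi : μ = Measure.infinitePi (fun _ : ℤ => ν) := by
    refine Measure.eq_infinitePi _ fun s t ht => ?_
    rw [← hμ s t ht]
    rfl
  have hcoord : ∀ i : ℤ, μ.map (fun ω => ω i) = ν := by
    intro i
    ext A hA
    rw [Measure.map_apply (measurable_pi_apply i) hA]
    have := hμ {i} (fun _ => A) (fun _ => hA)
    simp only [Finset.mem_singleton, forall_eq, Finset.prod_singleton] at this
    exact this
  have hshift : ∀ m, MeasurePreserving (shiftZ m) μ μ := by
    intro m
    refine ⟨measurable_shiftZ m, ?_⟩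
    conv_rhs => rw [hpi]
    refine Measure.eq_infinitePi _ fun s t ht => ?_
    rw [Measure.map_apply (measurable_shiftZ m)
      (MeasurableSet.pi s.countable_toSet fun i _ => ht i)]
    have := hμ (s.map (addRightEmbedding (m : ℤ))) (fun i => t (i - m)) (fun i => ht _)
    simp only [Finset.prod_map, addRightEmbedding_apply, add_sub_cancel_right] at this
    rw [← this]
    congr 1
    ext ω
    simp [shiftZ, Set.mem_pi]
  have hindF : ProbabilityTheory.iIndepFun (fun (i : ℤ) (ω : ℤ → ℝ) => ω i) μ := by
    rw [ProbabilityTheory.iIndepFun_iff_map_fun_eq_infinitePi_map (fun i => measurable_pi_apply i)]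
    simp only [hcoord]
    rw [← hpi]
    exact Measure.map_id
  have hind : ProbabilityTheory.iIndep (fun n : ℕ => MeasurableSpace.comap
      (fun ω : ℤ → ℝ => ω (n + 1)) inferInstance) μ := by
    have := hindF.precomp (g := fun n : ℕ => (n : ℤ) + 1) (fun a b h => by simpa using h)
    exact this
  -- the uniform bound
  obtain ⟨C, hC, hgood⟩ : ∃ C : ℝ, 0 ≤ C ∧ ∀ᵐ ω ∂μ, ω ∈ goodSet E C := by
    have hcont : Continuous (fun x : ℝ => LX E 1 (fun _ => x)) :=
      (continuous_LX E 1).comp (continuous_pi fun _ => continuous_id)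
    obtain ⟨C, hCb⟩ := hsupp_compact.bddAbove_image hcont.continuousOn
    refine ⟨max C 0, le_max_right _ _, ?_⟩
    have hall : ∀ᵐ ω ∂μ, ∀ i : ℤ, ω i ∈ msupp ν := by
      rw [ae_all_iff]
      intro i
      have h := ae_msupp ν
      rw [← hcoord i] at h
      have := ae_of_ae_map (measurable_pi_apply i).aemeasurable h
      rw [hcoord i] at this
      exact this
    filter_upwards [hall] with ω hω m
    have h1 : LX E 1 (shiftZ m ω) = LX E 1 (fun _ => ω (1 + m)) := by
      unfold LX
      rw [transferZ_congr E (shiftZ m ω) (fun _ => ω (1 + m)) 1]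
      intro i h1 h2
      obtain rfl : i = 1 := le_antisymm (by exact_mod_cast h2) h1
      rfl
    rw [h1]
    exact (hCb ⟨_, hω (1 + m), rfl⟩).trans (le_max_left _ _)
  have hLXint : ∀ n, Integrable (LX E n) μ := by
    intro n
    refine Integrable.of_bound (measurable_LX E n).aestronglyMeasurable (C * n) ?_
    filter_upwards [hgood] with ω hω
    rw [Real.norm_of_nonneg (LX_nonneg E n ω)]
    exact LX_le_good hω n
  -- the exponent
  let u : ℕ → ℝ := fun k => (∫ ω, LX E (k + 1) ω ∂μ) / ((k + 1 : ℕ) : ℝ)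
  have hu0 : ∀ k, 0 ≤ u k := fun k =>
    div_nonneg (integral_nonneg fun ω => LX_nonneg E _ ω) (Nat.cast_nonneg _)
  have hbdd : BddBelow (Set.range u) := ⟨0, by rintro _ ⟨k, rfl⟩; exact hu0 k⟩
  refine ⟨⨅ k, u k, le_ciInf hu0, ?_⟩
  set γ := ⨅ k, u k with hγdef
  have hγ : ∀ L : ℕ, 1 ≤ L → γ * L ≤ ∫ ω, LX E L ω ∂μ := by
    intro L hL
    obtain ⟨k, rfl⟩ := Nat.exists_eq_add_of_le' hL
    have h1 : γ ≤ u k := ciInf_le hbdd k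
    have h2 : (0 : ℝ) < ((k + 1 : ℕ) : ℝ) := by positivity
    exact (le_div_iff₀ h2).1 h1
  have hlow : ∀ᵐ ω ∂μ, ∀ q : ℚ, (q : ℝ) < γ → ω ∉ lowSet E q := by
    rw [ae_all_iff]
    intro q
    by_cases hq : (q : ℝ) < γ
    · have := lowSet_null E C q γ μ hC hgood hshift hind hLXint hγ hq
      filter_upwards [measure_eq_zero_iff_ae_notMem.1 this] with ω hω _ using hω
    · exact ae_of_all _ fun ω h => absurd h hq
  have hup : ∀ᵐ ω ∂μ, ∀ q : ℚ, γ < (q : ℝ) →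
      ∃ D : ℝ, ∀ᶠ n : ℕ in atTop, LX E n ω ≤ q * n + D := by
    rw [ae_all_iff]
    intro q
    by_cases hq : γ < (q : ℝ)
    · obtain ⟨k, hk⟩ := exists_lt_of_ciInf_lt hq
      have h2 : (0 : ℝ) < ((k + 1 : ℕ) : ℝ) := by positivity
      have hk' := (div_lt_iff₀ h2).1 hk
      filter_upwards [upper_bound E C q (k + 1) (by omega) μ hC hgood hshift hindF hLXint hk']
        with ω hω _ using ⟨_, hω⟩
    · exact ae_of_all _ fun ω h => absurd h hq
  filter_upwards [hlow, hup] with ω h1 h2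
  change Tendsto (fun n : ℕ => (1 / (n : ℝ)) * LX E n ω) atTop (nhds γ)
  rw [tendsto_order]
  constructor
  · intro a ha
    obtain ⟨q', hq1, hq2⟩ := exists_rat_btwn ha
    obtain ⟨q, hq3, hq4⟩ := exists_rat_btwn hq1
    have h3 := h1 q' hq2
    have h4 : ∀ᶠ n : ℕ in atTop, (q : ℝ) * n < LX E n ω := by
      by_contra hcon
      refine h3 ⟨q, hq4, ?_⟩
      intro hh
      apply hcon
      filter_upwards [hh] with n hn using not_le.1 hn
    filter_upwards [h4, eventually_ge_atTop 1] with n hn hn1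
    have hn0 : (0 : ℝ) < n := by exact_mod_cast hn1
    rw [one_div, inv_mul_eq_div, lt_div_iff₀ hn0]
    nlinarith
  · intro a ha
    obtain ⟨q, hq1, hq2⟩ := exists_rat_btwn ha
    obtain ⟨D, hD⟩ := h2 q hq1
    obtain ⟨N, hN⟩ := exists_nat_gt (D / (a - q))
    have hpos : 0 < a - q := by linarith
    rw [div_lt_iff₀ hpos] at hN
    filter_upwards [hD, eventually_ge_atTop 1, eventually_ge_atTop N] with n hn hn1 hn2
    have hn0 : (0 : ℝ) < n := by exact_mod_cast hn1
    have hn2' : (N : ℝ) ≤ n := by exact_mod_cast hn2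
    rw [one_div, inv_mul_eq_div, div_lt_iff₀ hn0]
    nlinarith
end
end

section
/- Let ν be a probability measure on SL(2,ℝ) satisfying ∫ log ‖M‖ dν(M) < ∞, and let G_ν be the smallest closed subgroup of SL(2,ℝ) containing supp ν. Assume (i) G_ν is not compact, and (ii) there is no finite non-empty subset L of the real projective line ℙ¹(ℝ) such that M·L = L for all M ∈ G_ν. Then there exists γ > 0 such that for ν^{ℕ}-almost every sequence (T_1, T_2, …) of matrices, (1/n) log ‖T_n ⋯ T_1‖ → γ as n → ∞. -/
open MeasureTheory Filter

noncomputable section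

/-- The group `SL(2,ℝ)`. -/
abbrev SL2 := Matrix.SpecialLinearGroup (Fin 2) ℝ

instance : TopologicalSpace SL2 := instTopologicalSpaceSubtype
instance : MeasurableSpace SL2 := borel SL2

/-- The real projective line `ℙ¹(ℝ)`, the projectivization of `ℝ² \ {0}`. -/
abbrev P1 := Projectivization ℝ (EuclideanSpace ℝ (Fin 2))

lemma sl2_inj (M : SL2) :
    Function.Injective (Matrix.toEuclideanCLM (𝕜 := ℝ) (M : Matrix (Fin 2) (Fin 2) ℝ)) := by
  intro x y h
  have h2 := congrArg (fun v => Matrix.toEuclideanCLM (𝕜 := ℝ)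
    ((M⁻¹ : SL2) : Matrix (Fin 2) (Fin 2) ℝ) v) h
  simpa [← ContinuousLinearMap.comp_apply, ← ContinuousLinearMap.mul_def, ← map_mul,
    Matrix.SpecialLinearGroup.coe_inv, Matrix.adjugate_mul, M.prop, one_smul] using h2

/-- The induced action of `M ∈ SL(2,ℝ)` on the real projective line. -/
def projAct (M : SL2) (x : P1) : P1 :=
  Projectivization.map
    ((Matrix.toEuclideanCLM (𝕜 := ℝ) (M : Matrix (Fin 2) (Fin 2) ℝ)) : _ →ₗ[ℝ] _)
    (sl2_inj M) x

/-- The smallest closed subgroup of `SL(2,ℝ)` containing the support of `ν`: the topological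
closure of the subgroup generated by `supp ν`. -/
def Gnu (ν : Measure SL2) : Set SL2 := closure (Subgroup.closure (msupp ν) : Set SL2)

/-- The ordered product `T n * ⋯ * T 1` (the value `T 0` is unused). -/
def Pprod (T : ℕ → SL2) : ℕ → SL2
  | 0 => 1
  | n + 1 => T (n + 1) * Pprod T n

/-! Deterministic bounds for subadditive cocycles -/

lemma cocycle_le_sum {Ω : Type*} (σ : Ω → Ω) (L : ℕ → Ω → ℝ) (hL0 : ∀ T, L 0 T = 0)
    (hsub : ∀ n m T, L (n + m) T ≤ L n T + L m (σ^[n] T)) (n : ℕ) (T : Ω) :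
    L n T ≤ ∑ i ∈ Finset.range n, L 1 (σ^[i] T) := by
  induction n with
  | zero => simp [hL0]
  | succ n ih =>
    rw [Finset.sum_range_succ]
    exact (hsub n 1 T).trans (by linarith)

lemma cocycle_le_blocks {Ω : Type*} (σ : Ω → Ω) (L : ℕ → Ω → ℝ) (hL0 : ∀ T, L 0 T = 0)
    (hsub : ∀ n m T, L (n + m) T ≤ L n T + L m (σ^[n] T)) (k m : ℕ) (T : Ω) :
    L (m * k) T ≤ ∑ j ∈ Finset.range m, L k (σ^[j * k] T) := by
  induction m with
  | zero => simp [hL0]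
  | succ n ih =>
    rw [Finset.sum_range_succ, Nat.succ_mul]
    exact (hsub (n * k) k T).trans (by linarith)

lemma cocycle_le_main {Ω : Type*} (σ : Ω → Ω) (L : ℕ → Ω → ℝ) (hL0 : ∀ T, L 0 T = 0)
    (h0 : ∀ n T, 0 ≤ L n T)
    (hsub : ∀ n m T, L (n + m) T ≤ L n T + L m (σ^[n] T)) (k : ℕ) (hk : 1 ≤ k) (n : ℕ) (T : Ω) :
    L n T ≤ ∑ j ∈ Finset.range (n / k), L k (σ^[j * k] T) +
      (∑ i ∈ Finset.range (n / k * k + k), L 1 (σ^[i] T) -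
        ∑ i ∈ Finset.range (n / k * k), L 1 (σ^[i] T)) := by
  have h1 : L n T ≤ L (n / k * k) T + L (n % k) (σ^[n / k * k] T) := by
    have := hsub (n / k * k) (n % k) T
    rwa [Nat.div_add_mod' n k] at this
  have h2 := cocycle_le_blocks σ L hL0 hsub k (n / k) T
  have h3 := cocycle_le_sum σ L hL0 hsub (n % k) (σ^[n / k * k] T)
  have h4 : ∑ i ∈ Finset.range (n % k), L 1 (σ^[i] (σ^[n / k * k] T)) ≤
      ∑ i ∈ Finset.range k, L 1 (σ^[i] (σ^[n / k * k] T)) := by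
    apply Finset.sum_le_sum_of_subset_of_nonneg
    · exact Finset.range_mono (Nat.mod_lt n (by omega)).le
    · intros; exact h0 _ _
  have h5 : ∑ i ∈ Finset.range (n / k * k + k), L 1 (σ^[i] T) =
      ∑ i ∈ Finset.range (n / k * k), L 1 (σ^[i] T) +
        ∑ i ∈ Finset.range k, L 1 (σ^[i] (σ^[n / k * k] T)) := by
    rw [Finset.sum_range_add]
    congr 1
    apply Finset.sum_congr rfl
    intro i _
    rw [← Function.iterate_add_apply, add_comm]
  linarith

lemma tendsto_div_nat (k : ℕ) (hk : 1 ≤ k) :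
    Tendsto (fun n : ℕ => ((n / k : ℕ) : ℝ) / n) atTop (nhds (1 / k : ℝ)) := by
  have h := (tendsto_nat_floor_mul_div_atTop (R := ℝ) (a := 1 / (k : ℝ)) (by positivity)).comp
    tendsto_natCast_atTop_atTop
  refine h.congr fun n => ?_
  simp only [Function.comp]
  congr 2
  rw [one_div_mul_eq_div]
  exact Nat.floor_div_eq_div (K := ℝ) n k

lemma tendsto_comp_div (a : ℕ → ℝ) (e : ℝ) (ha : Tendsto (fun n : ℕ => a n / n) atTop (nhds e))
    (φ : ℕ → ℕ) (hφ : Tendsto φ atTop atTop) (c : ℝ)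
    (hc : Tendsto (fun n : ℕ => (φ n : ℝ) / n) atTop (nhds c)) :
    Tendsto (fun n : ℕ => a (φ n) / n) atTop (nhds (e * c)) := by
  have h := (ha.comp hφ).mul hc
  refine h.congr' ?_
  filter_upwards [hφ.eventually_ge_atTop 1] with n hn
  simp only [Function.comp]
  have : (φ n : ℝ) ≠ 0 := by positivity
  field_simp

lemma limsup_bound {Ω : Type*} (σ : Ω → Ω) (L : ℕ → Ω → ℝ) (hL0 : ∀ T, L 0 T = 0)
    (h0 : ∀ n T, 0 ≤ L n T)
    (hsub : ∀ n m T, L (n + m) T ≤ L n T + L m (σ^[n] T)) (k : ℕ) (hk : 1 ≤ k) (T : Ω)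
    (ek e1 : ℝ)
    (hA : Tendsto (fun m : ℕ => (∑ j ∈ Finset.range m, L k (σ^[j * k] T)) / m) atTop (nhds ek))
    (hS : Tendsto (fun m : ℕ => (∑ j ∈ Finset.range m, L 1 (σ^[j] T)) / m) atTop (nhds e1))
    (c : ℝ) (hc : ek / k < c) : ∀ᶠ n : ℕ in atTop, L n T / n < c := by
  have hk' : (k : ℝ) ≠ 0 := by positivity
  have hd := tendsto_div_nat k hk
  have hφ : Tendsto (fun n : ℕ => n / k) atTop atTop := Nat.tendsto_div_const_atTop (by omega)
  have t1 := tendsto_comp_div _ _ hA _ hφ _ hd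
  have c2 : Tendsto (fun n : ℕ => ((n / k * k : ℕ) : ℝ) / n) atTop (nhds 1) := by
    have := hd.mul_const (k : ℝ)
    rw [one_div_mul_cancel hk'] at this
    refine this.congr fun n => ?_
    push_cast; ring
  have c3 : Tendsto (fun n : ℕ => ((n / k * k + k : ℕ) : ℝ) / n) atTop (nhds 1) := by
    have := c2.add (tendsto_const_div_atTop_nhds_zero_nat (k : ℝ))
    rw [add_zero] at this
    refine this.congr fun n => ?_
    push_cast; ring
  have hφ2 : Tendsto (fun n : ℕ => n / k * k) atTop atTop :=
    tendsto_atTop_mono (fun n => Nat.le_mul_of_pos_right _ (by omega)) hφ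
  have hφ3 : Tendsto (fun n : ℕ => n / k * k + k) atTop atTop :=
    tendsto_atTop_mono (fun n => Nat.le_add_right _ _) hφ2
  have t2 := tendsto_comp_div _ _ hS _ hφ2 _ c2
  have t3 := tendsto_comp_div _ _ hS _ hφ3 _ c3
  have t := t1.add (t3.sub t2)
  have hlim : ek * (1 / k) + (e1 * 1 - e1 * 1) < c := by
    have : ek * (1 / (k : ℝ)) = ek / k := by ring
    linarith
  filter_upwards [t.eventually_lt_const hlim] with n hn
  refine lt_of_le_of_lt ?_ hn
  have := cocycle_le_main σ L hL0 h0 hsub k hk n T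
  rw [← sub_div, ← add_div]
  gcongr

/-- Katznelson-Weiss covering inequality. -/
lemma kw_cover {Ω : Type*} (σ : Ω → Ω) (L : ℕ → Ω → ENNReal) (hL0 : ∀ T, L 0 T = 0)
    (hsub : ∀ n m T, L (n + m) T ≤ L n T + L m (σ^[n] T))
    (l : Ω → ENNReal) (hl : ∀ T, l (σ T) ≤ l T) (ε : ENNReal) (N : ℕ) (B : Set Ω)
    (hB : ∀ T, T ∉ B → ∃ τ, 1 ≤ τ ∧ τ ≤ N ∧ L τ T ≤ τ * (l T + ε)) (n : ℕ) (T : Ω) :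
    L n T ≤ n * (l T + ε) + ∑ i ∈ Finset.range n, B.indicator (L 1) (σ^[i] T) +
      ∑ i ∈ Finset.Ico (n - N) n, L 1 (σ^[i] T) := by
  have hl' : ∀ k T, l (σ^[k] T) ≤ l T := by
    intro k
    induction k with
    | zero => intro T; simp
    | succ k ih =>
      intro T
      rw [Function.iterate_succ_apply]
      exact (ih _).trans (hl T)
  -- shifting the right-hand side
  have key : ∀ τ r : ℕ, ∀ T : Ω, L r (σ^[τ] T) ≤ r * (l (σ^[τ] T) + ε)
        + ∑ i ∈ Finset.range r, B.indicator (L 1) (σ^[i] (σ^[τ] T)) +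
        ∑ i ∈ Finset.Ico (r - N) r, L 1 (σ^[i] (σ^[τ] T)) →
      L r (σ^[τ] T) ≤ r * (l T + ε)
        + ∑ i ∈ Finset.Ico τ (τ + r), B.indicator (L 1) (σ^[i] T) +
        ∑ i ∈ Finset.Ico (τ + r - N) (τ + r), L 1 (σ^[i] T) := by
    intro τ r T h
    refine h.trans ?_
    refine add_le_add (add_le_add (mul_le_mul_right (add_le_add (hl' τ T) le_rfl) _) ?_) ?_
    · simp only [← Function.iterate_add_apply]
      rw [Finset.range_eq_Ico, Finset.sum_Ico_add' (fun i => B.indicator (L 1) (σ^[i] T))]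
      simp [add_comm]
    · simp only [← Function.iterate_add_apply]
      rw [Finset.sum_Ico_add' (fun i => L 1 (σ^[i] T))]
      apply Finset.sum_le_sum_of_subset
      apply Finset.Ico_subset_Ico <;> omega
  induction n using Nat.strong_induction_on generalizing T with
  | _ n ih =>
  rcases Nat.eq_zero_or_pos n with rfl | hn
  · simp [hL0]
  by_cases hT : T ∈ B
  · obtain ⟨r, rfl⟩ : ∃ r, n = 1 + r := ⟨n - 1, by omega⟩
    have h1 := key 1 r T (ih r (by omega) (σ^[1] T))
    refine (hsub 1 r T).trans ?_
    calc L 1 T + L r (σ^[1] T) ≤ L 1 T + _ := add_le_add le_rfl h1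
      _ = r * (l T + ε) + (B.indicator (L 1) (σ^[0] T) +
        ∑ i ∈ Finset.Ico 1 (1 + r), B.indicator (L 1) (σ^[i] T)) +
        ∑ i ∈ Finset.Ico (1 + r - N) (1 + r), L 1 (σ^[i] T) := by
          simp only [Function.iterate_zero, id, Set.indicator_of_mem hT]
          ring
      _ ≤ _ := by
          refine add_le_add (add_le_add (mul_le_mul_left ?_ _) ?_) le_rfl
          · simp
          · rw [Finset.range_eq_Ico,
              Finset.sum_eq_sum_Ico_succ_bot (a := 0) (b := 1 + r) (by omega)]
  · obtain ⟨τ, h1, h2, h3⟩ := hB T hT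
    by_cases hτ : τ ≤ n
    · obtain ⟨r, rfl⟩ : ∃ r, n = τ + r := ⟨n - τ, by omega⟩
      have h4 := key τ r T (ih r (by omega) (σ^[τ] T))
      refine (hsub τ r T).trans ?_
      calc L τ T + L r (σ^[τ] T) ≤ τ * (l T + ε) + _ := add_le_add h3 h4
        _ = (τ + r : ℕ) * (l T + ε) + (
          ∑ i ∈ Finset.Ico τ (τ + r), B.indicator (L 1) (σ^[i] T)) +
          ∑ i ∈ Finset.Ico (τ + r - N) (τ + r), L 1 (σ^[i] T) := by
            push_cast
            ring
        _ ≤ _ := by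
            refine add_le_add (add_le_add le_rfl ?_) le_rfl
            apply Finset.sum_le_sum_of_subset
            intro i hi
            simp at hi ⊢; omega
    · have h5 : ∀ m, L m T ≤ ∑ i ∈ Finset.range m, L 1 (σ^[i] T) := by
        intro m
        induction m with
        | zero => simp [hL0]
        | succ m ihm =>
          rw [Finset.sum_range_succ]
          exact (hsub m 1 T).trans (by gcongr)
      have : n - N = 0 := by omega
      rw [this, ← Finset.range_eq_Ico]
      exact (h5 n).trans le_add_self

lemma kw_lintegral {Ω : Type*} [MeasurableSpace Ω] (μ : Measure Ω) [IsProbabilityMeasure μ]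
    (σ : Ω → Ω) (hσ : MeasurePreserving σ μ μ)
    (L : ℕ → Ω → ENNReal) (hm : ∀ n, Measurable (L n)) (hL0 : ∀ T, L 0 T = 0)
    (hsub : ∀ n m T, L (n + m) T ≤ L n T + L m (σ^[n] T))
    (hint : ∫⁻ T, L 1 T ∂μ ≠ ⊤) (γ : ENNReal) (hγ : ∀ n : ℕ, n * γ ≤ ∫⁻ T, L n T ∂μ)
    (l : Ω → ENNReal) (hl : ∀ T, l (σ T) ≤ l T) (hlm : Measurable l)
    (hlL : ∀ T, ∀ c, l T < c → ∃ n : ℕ, 1 ≤ n ∧ L n T ≤ n * c) :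
    γ ≤ ∫⁻ T, l T ∂μ := by
  have hσi : ∀ i, MeasurePreserving σ^[i] μ μ := fun i => hσ.iterate i
  refine ENNReal.le_of_forall_pos_le_add fun ε hε _ => ?_
  have hε' : (ε : ENNReal) ≠ 0 := by simpa using hε.ne'
  let B : ℕ → Set Ω := fun N => {T | ∀ τ, 1 ≤ τ → τ ≤ N → τ * (l T + ε) < L τ T}
  have hBm : ∀ N, MeasurableSet (B N) := by
    intro N
    have : B N = ⋂ τ : ℕ, ⋂ (_ : 1 ≤ τ), ⋂ (_ : τ ≤ N), {T | τ * (l T + ε) < L τ T} := by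
      ext T; simp [B]
    rw [this]
    refine MeasurableSet.iInter fun τ => MeasurableSet.iInter fun _ => MeasurableSet.iInter fun _ => ?_
    exact measurableSet_lt ((hlm.add_const _).const_mul _) (hm τ)
  have hBN : ∀ N T, T ∉ B N → ∃ τ, 1 ≤ τ ∧ τ ≤ N ∧ L τ T ≤ τ * (l T + ε) := by
    intro N T hT
    simp only [B, Set.mem_ofPred_eq, not_forall, not_lt] at hT
    obtain ⟨τ, h1, h2, h3⟩ := hT
    exact ⟨τ, h1, h2, h3⟩
  -- Step 1
  have step1 : ∀ N n : ℕ, n * γ ≤ n * (∫⁻ T, l T ∂μ + ε) + n * (∫⁻ T in B N, L 1 T ∂μ)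
      + N * ∫⁻ T, L 1 T ∂μ := by
    intro N n
    refine (hγ n).trans ?_
    refine (lintegral_mono fun T => kw_cover σ L hL0 hsub l hl ε N (B N) (hBN N) n T).trans ?_
    have hi1 : ∀ i, Measurable fun T => (B N).indicator (L 1) (σ^[i] T) := fun i =>
      ((hm 1).indicator (hBm N)).comp (hσi i).measurable
    have hi2 : ∀ i, Measurable fun T => L 1 (σ^[i] T) := fun i =>
      (hm 1).comp (hσi i).measurable
    rw [lintegral_add_right _ (Finset.measurable_sum _ fun i _ => hi2 i),
      lintegral_add_right _ (Finset.measurable_sum _ fun i _ => hi1 i),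
      lintegral_const_mul _ (hlm.add_const _), lintegral_add_right _ measurable_const,
      lintegral_finsetSum _ (fun i _ => hi1 i), lintegral_finsetSum _ (fun i _ => hi2 i)]
    have e1 : ∀ i, ∫⁻ T, (B N).indicator (L 1) (σ^[i] T) ∂μ = ∫⁻ T in B N, L 1 T ∂μ := by
      intro i
      rw [(hσi i).lintegral_comp ((hm 1).indicator (hBm N)), lintegral_indicator (hBm N)]
    have e2 : ∀ i, ∫⁻ T, L 1 (σ^[i] T) ∂μ = ∫⁻ T, L 1 T ∂μ := fun i =>
      (hσi i).lintegral_comp (hm 1)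
    simp only [e1, e2, Finset.sum_const, lintegral_const, measure_univ, mul_one, nsmul_eq_mul,
      Finset.card_range, Nat.card_Ico]
    refine add_le_add le_rfl (mul_le_mul_left ?_ _)
    exact_mod_cast (by omega : n - (n - N) ≤ N)
  -- Step 2
  have step2 : ∀ N : ℕ, γ ≤ (∫⁻ T, l T ∂μ + ε) + (∫⁻ T in B N, L 1 T ∂μ) := by
    intro N
    have ht : Tendsto (fun n : ℕ => (∫⁻ T, l T ∂μ + ε) + (∫⁻ T in B N, L 1 T ∂μ)
      + (N * ∫⁻ T, L 1 T ∂μ) / n) atTop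
      (nhds ((∫⁻ T, l T ∂μ + ε) + (∫⁻ T in B N, L 1 T ∂μ) + 0)) := by
      refine tendsto_const_nhds.add ?_
      have h := ENNReal.Tendsto.const_div ENNReal.tendsto_nat_nhds_top
        (a := N * ∫⁻ T, L 1 T ∂μ) (Or.inr (ENNReal.mul_ne_top (by simp) hint))
      rwa [ENNReal.div_top] at h
    rw [add_zero] at ht
    refine ge_of_tendsto ht ?_
    filter_upwards [eventually_ge_atTop 1] with n hn
    have hn0 : (n : ENNReal) ≠ 0 := by simp; omega
    have := step1 N n
    rw [← ENNReal.mul_le_mul_iff_right hn0 (by simp)]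
    refine this.trans (le_of_eq ?_)
    rw [← mul_add, mul_add _ _ (_ / _), ENNReal.mul_div_cancel hn0 (by simp)]
  -- Step 3
  have hanti : Antitone B := by
    intro a b hab T hT τ h1 h2
    exact hT τ h1 (h2.trans hab)
  have hinter : ⋂ N, B N = ∅ := by
    ext T
    simp only [Set.mem_iInter, Set.mem_empty_iff_false, iff_false, not_forall]
    by_cases htop : l T = ⊤
    · refine ⟨1, fun h => ?_⟩
      have := h 1 le_rfl le_rfl
      simp [htop] at this
    · obtain ⟨n, h1, h2⟩ := hlL T (l T + ε) (ENNReal.lt_add_right htop hε')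
      exact ⟨n, fun h => absurd (h n h1 le_rfl) (not_lt.2 h2)⟩
  have step3 : Tendsto (fun N => ∫⁻ T in B N, L 1 T ∂μ) atTop (nhds 0) := by
    refine tendsto_setLIntegral_zero (f := L 1) hint ?_
    have := tendsto_measure_iInter_atTop (μ := μ) (fun N => (hBm N).nullMeasurableSet) hanti
      ⟨0, measure_ne_top _ _⟩
    rwa [hinter, measure_empty] at this
  have := ge_of_tendsto (tendsto_const_nhds.add step3) (Eventually.of_forall step2)
  simpa using this

theorem subadd_ergodic {Ω : Type*} [MeasurableSpace Ω] (μ : Measure Ω) [IsProbabilityMeasure μ]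
    (σ : Ω → Ω) (hσ : MeasurePreserving σ μ μ)
    (L : ℕ → Ω → ℝ) (hm : ∀ n, Measurable (L n)) (h0 : ∀ n T, 0 ≤ L n T)
    (hL0 : ∀ T, L 0 T = 0)
    (hsub : ∀ n m T, L (n + m) T ≤ L n T + L m (σ^[n] T))
    (hint : Integrable (L 1) μ) (h : Ω → ℝ) 
    (hinv : ∀ n T, L n (σ T) ≤ L (n + 1) T + h T)
    (hlln : ∀ k, 1 ≤ k → Integrable (L k) μ → ∀ᵐ T ∂μ,
      Tendsto (fun m : ℕ => (∑ j ∈ Finset.range m, L k (σ^[j * k] T)) / m) atTop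
        (nhds (∫ T, L k T ∂μ))) :
    ∃ γ : ℝ, Tendsto (fun n : ℕ => (∫ T, L n T ∂μ) / n) atTop (nhds γ) ∧
      ∀ᵐ T ∂μ, Tendsto (fun n : ℕ => L n T / n) atTop (nhds γ) := by
  have hσi : ∀ i, MeasurePreserving σ^[i] μ μ := fun i => hσ.iterate i
  have hLint : ∀ n, Integrable (L n) μ := by
    intro n
    induction n with
    | zero => simp [funext hL0]
    | succ n ih =>
      refine (ih.add ((hσi n).integrable_comp_of_integrable hint)).mono'
        (hm _).aestronglyMeasurable (Eventually.of_forall fun T => ?_)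
      rw [Real.norm_of_nonneg (h0 _ _)]
      exact hsub n 1 T
  have hsubad : Subadditive fun n => ∫ T, L n T ∂μ := by
    intro n m
    simp only
    have : ∫ T, L m T ∂μ = ∫ T, L m (σ^[n] T) ∂μ := by
      rw [← (hσi n).map_eq, integral_map (hσi n).measurable.aemeasurable
        (hm m).aestronglyMeasurable, (hσi n).map_eq]
    have hi : Integrable (fun T => L m (σ^[n] T)) μ :=
      (hσi n).integrable_comp_of_integrable (hLint m)
    rw [this, ← integral_add (hLint n) hi]
    exact integral_mono (hLint _) ((hLint n).add hi) (fun T => hsub n m T)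
  have hbdd : BddBelow (Set.range fun n : ℕ => (∫ T, L n T ∂μ) / n) := by
    refine ⟨0, ?_⟩
    rintro _ ⟨n, rfl⟩
    exact div_nonneg (integral_nonneg (h0 n)) (by positivity)
  have htend := hsubad.tendsto_lim hbdd
  set γ := hsubad.lim with hγdef
  have hγ0 : 0 ≤ γ := ge_of_tendsto htend (Eventually.of_forall fun n =>
    div_nonneg (integral_nonneg (h0 n)) (by positivity))
  refine ⟨γ, htend, ?_⟩
  -- upper bound
  have hup : ∀ᵐ T ∂μ, ∀ c, γ < c → ∀ᶠ n : ℕ in atTop, L n T / n < c := by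
    have hall : ∀ᵐ T ∂μ, ∀ k, 1 ≤ k →
      Tendsto (fun m : ℕ => (∑ j ∈ Finset.range m, L k (σ^[j * k] T)) / m) atTop
        (nhds (∫ T, L k T ∂μ)) := by
      rw [ae_all_iff]
      intro k
      by_cases hk : 1 ≤ k
      · filter_upwards [hlln k hk (hLint k)] with T hT _ using hT
      · simp [hk]
    filter_upwards [hall] with T hT c hc
    obtain ⟨k, hk1, hk2⟩ := ((htend.eventually_lt_const hc).and (eventually_ge_atTop 1)).exists
    refine limsup_bound σ L hL0 h0 hsub k hk2 T _ (∫ T, L 1 T ∂μ) (hT k hk2) ?_ c hk1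
    simpa using hT 1 le_rfl
  let u : ℕ → Ω → ENNReal := fun n T => ENNReal.ofReal (L n T / n)
  let l : Ω → ENNReal := fun T => liminf (fun n => u n T) atTop
  have hum : ∀ n, Measurable (u n) := fun n => ((hm n).div_const _).ennreal_ofReal
  have hlm : Measurable l := Measurable.liminf hum
  have hl : ∀ T, l (σ T) ≤ l T := by
    intro T
    refine le_of_forall_gt_imp_ge_of_dense fun c hc => ?_
    obtain ⟨c', hc1, hc2⟩ := exists_between hc
    have hf : ∃ᶠ n in atTop, u n T < c' := frequently_lt_of_liminf_lt (by isBoundedDefault) hc1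
    by_cases hct : c = ⊤
    · simp [hct]
    refine liminf_le_of_frequently_le' ?_
    have hc't : c' ≠ ⊤ := (hc2.trans_le le_top).ne
    lift c to NNReal using hct
    lift c' to NNReal using hc't
    have hcc : (c' : ℝ) < c := by exact_mod_cast hc2
    have hz : ∀ᶠ n : ℕ in atTop, (c' + h T) / (n : ℝ) < c - c' :=
      (tendsto_const_div_atTop_nhds_zero_nat _).eventually_lt_const (by linarith)
    have hf2 : ∃ᶠ n : ℕ in atTop, u (n + 1) T < c' := by
      have := hf
      rw [← map_add_atTop_eq_nat 1, frequently_map] at this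
      exact this
    refine (hf2.and_eventually (hz.and (eventually_ge_atTop 1))).mono ?_
    rintro n ⟨h1, h2, h3⟩
    have hn : (0 : ℝ) < n := by exact_mod_cast h3
    have hn1 : (0 : ℝ) < (n : ℝ) + 1 := by positivity
    have h4 : L (n + 1) T / ((n + 1 : ℕ) : ℝ) < c' := by
      have h1' : ENNReal.ofReal (L (n + 1) T / ((n + 1 : ℕ) : ℝ)) < ENNReal.ofReal c' := by
        simpa [u] using h1
      exact (ENNReal.ofReal_lt_ofReal_iff'.mp h1').1
    push_cast at h4
    rw [div_lt_iff₀ hn1] at h4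
    rw [div_lt_iff₀ hn] at h2
    have h5 := hinv n T
    have h6 : L n (σ T) / n ≤ c := by
      rw [div_le_iff₀ hn]
      nlinarith
    calc u n (σ T) ≤ ENNReal.ofReal c := ENNReal.ofReal_le_ofReal h6
      _ = c := by simp
  have hlow : ENNReal.ofReal γ ≤ ∫⁻ T, l T ∂μ := by
    refine kw_lintegral μ σ hσ (fun n T => ENNReal.ofReal (L n T)) (fun n => (hm n).ennreal_ofReal)
      (by simp [hL0]) ?_ ?_ _ ?_ l hl hlm ?_
    · intro n m T
      rw [← ENNReal.ofReal_add (h0 _ _) (h0 _ _)]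
      exact ENNReal.ofReal_le_ofReal (hsub n m T)
    · exact hint.lintegral_lt_top.ne
    · intro n
      rw [← ofReal_integral_eq_lintegral_ofReal (hLint n) (Eventually.of_forall (h0 n))]
      rw [← ENNReal.ofReal_natCast, ← ENNReal.ofReal_mul (by positivity)]
      refine ENNReal.ofReal_le_ofReal ?_
      rcases Nat.eq_zero_or_pos n with rfl | hn
      · simp [hL0]
      · have := hsubad.lim_le_div hbdd hn.ne'
        rw [le_div_iff₀ (by exact_mod_cast hn)] at this
        linarith
    · intro T c hc
      have hf : ∃ᶠ n in atTop, u n T < c := frequently_lt_of_liminf_lt (by isBoundedDefault) hc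
      obtain ⟨n, h1, h2⟩ := (hf.and_eventually (eventually_ge_atTop 1)).exists
      refine ⟨n, h2, ?_⟩
      have hn : (0 : ℝ) < n := by exact_mod_cast h2
      have : L n T = n * (L n T / n) := by field_simp
      rw [this, ENNReal.ofReal_mul hn.le, ENNReal.ofReal_natCast]
      exact mul_le_mul_right h1.le _
  have hup2 : ∀ᵐ T ∂μ, limsup (fun n => u n T) atTop ≤ ENNReal.ofReal γ := by
    filter_upwards [hup] with T hT
    have h1 : ∀ ε : ℝ, 0 < ε → limsup (fun n => u n T) atTop ≤ ENNReal.ofReal (γ + ε) := by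
      intro ε hε
      refine limsup_le_of_le (by isBoundedDefault) ?_
      filter_upwards [hT (γ + ε) (by linarith)] with n hn
      exact ENNReal.ofReal_le_ofReal hn.le
    have h2 : Tendsto (fun ε : ℝ => ENNReal.ofReal (γ + ε)) (nhdsWithin 0 (Set.Ioi 0))
        (nhds (ENNReal.ofReal (γ + 0))) :=
      (ENNReal.continuous_ofReal.comp (continuous_const.add continuous_id)).continuousAt.tendsto.mono_left
        nhdsWithin_le_nhds
    rw [add_zero] at h2
    refine ge_of_tendsto h2 ?_
    filter_upwards [self_mem_nhdsWithin] with ε hε using h1 ε hε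
  have hle : ∀ᵐ T ∂μ, l T ≤ ENNReal.ofReal γ := by
    filter_upwards [hup2] with T hT
    exact (liminf_le_limsup (by isBoundedDefault) (by isBoundedDefault)).trans hT
  have heq : l =ᵐ[μ] fun _ => ENNReal.ofReal γ := by
    refine ae_eq_of_ae_le_of_lintegral_le hle ?_ aemeasurable_const ?_
    · refine ((lintegral_mono_ae hle).trans_lt ?_).ne
      simp
    · simpa using hlow
  filter_upwards [hup2, heq] with T h1 h2
  have ht : Tendsto (fun n => u n T) atTop (nhds (ENNReal.ofReal γ)) :=
    tendsto_of_le_liminf_of_limsup_le h2.ge h1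
  have := (ENNReal.continuousAt_toReal (by simp)).tendsto.comp ht
  rw [ENNReal.toReal_ofReal hγ0] at this
  refine this.congr fun n => ?_
  simp only [Function.comp, u]
  exact ENNReal.toReal_ofReal (div_nonneg (h0 _ _) (by positivity))

instance : BorelSpace SL2 := ⟨rfl⟩

lemma sl2_coe_continuous : Continuous (fun M : SL2 => (M : Matrix (Fin 2) (Fin 2) ℝ)) :=
  continuous_subtype_val

instance : IsTopologicalGroup SL2 := Matrix.SpecialLinearGroup.topologicalGroup

instance : SecondCountableTopology SL2 := by
  have : SecondCountableTopology (Matrix (Fin 2) (Fin 2) ℝ) :=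
    inferInstanceAs (SecondCountableTopology (Fin 2 → Fin 2 → ℝ))
  exact Topology.IsEmbedding.subtypeVal.secondCountableTopology

example : MeasurableMul₂ SL2 := inferInstance

/-- the continuous linear map of a matrix in `SL2` -/
def lact (M : SL2) : EuclideanSpace ℝ (Fin 2) →L[ℝ] EuclideanSpace ℝ (Fin 2) :=
  Matrix.toEuclideanCLM (𝕜 := ℝ) (M : Matrix (Fin 2) (Fin 2) ℝ)

lemma lact_mul (M N : SL2) : lact (M * N) = (lact M).comp (lact N) := by
  simp [lact, ContinuousLinearMap.mul_def]

lemma lact_mul_apply (M N : SL2) (x : EuclideanSpace ℝ (Fin 2)) :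
    lact (M * N) x = lact M (lact N x) := by
  rw [lact_mul]; rfl

lemma lact_one : lact 1 = ContinuousLinearMap.id ℝ _ := by
  simp [lact]; rfl

lemma lact_one_apply (x : EuclideanSpace ℝ (Fin 2)) : lact 1 x = x := by
  rw [lact_one]; rfl

lemma lact_continuous : Continuous lact := by
  have h : Continuous (Matrix.toEuclideanCLM (n := Fin 2) (𝕜 := ℝ)) :=
    LinearMap.continuous_of_finiteDimensional
      ((Matrix.toEuclideanCLM (n := Fin 2) (𝕜 := ℝ)).toAlgEquiv.toLinearMap)
  exact h.comp sl2_coe_continuous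

/-- the operator norm on `SL2` -/
def nrm (M : SL2) : ℝ := opNorm (M : Matrix (Fin 2) (Fin 2) ℝ)

lemma nrm_eq (M : SL2) : nrm M = ‖lact M‖ := rfl

lemma nrm_continuous : Continuous nrm := lact_continuous.norm

lemma nrm_mul (M N : SL2) : nrm (M * N) ≤ nrm M * nrm N := by
  simp only [nrm_eq, lact_mul]
  exact ContinuousLinearMap.opNorm_comp_le _ _

lemma lact_coord (M : SL2) (x : EuclideanSpace ℝ (Fin 2)) (i : Fin 2) :
    lact M x i = M i 0 * x 0 + M i 1 * x 1 := by
  have h : lact M x i = ((M : Matrix (Fin 2) (Fin 2) ℝ).mulVec x.ofLp) i := by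
    rw [lact, ← Matrix.ofLp_toEuclideanCLM]
  rw [h]
  simp [Matrix.mulVec, dotProduct, Fin.sum_univ_two]

lemma nrm_ge_one (M : SL2) : 1 ≤ nrm M := by
  have hcol : ∀ j : Fin 2, M 0 j ^ 2 + M 1 j ^ 2 ≤ nrm M ^ 2 := by
    intro j
    have h1 : ‖lact M (EuclideanSpace.single j 1)‖ ≤ nrm M := by
      have := (lact M).le_opNorm (EuclideanSpace.single j 1)
      simpa [nrm_eq] using this
    have h2 : ‖lact M (EuclideanSpace.single j 1)‖ ^ 2 = M 0 j ^ 2 + M 1 j ^ 2 := by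
      rw [EuclideanSpace.norm_sq_eq, Fin.sum_univ_two, lact_coord, lact_coord]
      fin_cases j <;> simp
    rw [← h2]
    gcongr
  have hdet : M 0 0 * M 1 1 - M 0 1 * M 1 0 = 1 := by
    have := M.prop
    rwa [Matrix.det_fin_two] at this
  have h0 := hcol 0
  have h1 := hcol 1
  have hn : 0 ≤ nrm M := norm_nonneg _
  by_contra hlt
  push Not at hlt
  have hsq : nrm M ^ 2 < 1 := by nlinarith
  nlinarith [sq_nonneg (M 0 0 - M 1 1), sq_nonneg (M 0 1 + M 1 0)]

lemma nrm_one : nrm 1 = 1 := by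
  rw [nrm_eq, lact_one]
  exact ContinuousLinearMap.norm_id

lemma nrm_pos (M : SL2) : 0 < nrm M := lt_of_lt_of_le one_pos (nrm_ge_one M)

/-- the shift -/
def sh (T : ℕ → SL2) : ℕ → SL2 := fun i => T (i + 1)

lemma sh_iter (n : ℕ) (T : ℕ → SL2) (i : ℕ) : sh^[n] T i = T (i + n) := by
  induction n generalizing T with
  | zero => rfl
  | succ n ih =>
    rw [Function.iterate_succ_apply, ih]
    simp only [sh]
    congr 1

lemma sh_measurable : Measurable sh := measurable_pi_lambda _ fun i => measurable_pi_apply _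

lemma Pprod_add (n m : ℕ) (T : ℕ → SL2) : Pprod T (n + m) = Pprod (sh^[n] T) m * Pprod T n := by
  induction m with
  | zero => simp [Pprod]
  | succ m ih =>
    rw [← add_assoc, Pprod, Pprod, ih, mul_assoc, sh_iter]
    congr 2
    omega

lemma Pprod_one (T : ℕ → SL2) : Pprod T 1 = T 1 := by simp [Pprod]

lemma Pprod_measurable (n : ℕ) : Measurable (fun T => Pprod T n) := by
  induction n with
  | zero => exact measurable_const
  | succ n ih => exact (measurable_pi_apply _).mul ih

/-- coordinates on which the product depends -/
lemma Pprod_congr (n : ℕ) (T S : ℕ → SL2) (h : ∀ i, 1 ≤ i → i ≤ n → T i = S i) :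
    Pprod T n = Pprod S n := by
  induction n with
  | zero => rfl
  | succ n ih =>
    rw [Pprod, Pprod, ih (fun i h1 h2 => h i h1 (by omega)), h (n + 1) (by omega) le_rfl]

/-- log norm of products -/
def Lg (n : ℕ) (T : ℕ → SL2) : ℝ := Real.log (nrm (Pprod T n))

lemma Lg_measurable (n : ℕ) : Measurable (Lg n) :=
  Real.measurable_log.comp (nrm_continuous.measurable.comp (Pprod_measurable n))

lemma Lg_nonneg (n : ℕ) (T : ℕ → SL2) : 0 ≤ Lg n T := Real.log_nonneg (nrm_ge_one _)

lemma Lg_zero (T : ℕ → SL2) : Lg 0 T = 0 := by simp [Lg, Pprod, nrm_one]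

lemma log_nrm_mul (M N : SL2) : Real.log (nrm (M * N)) ≤ Real.log (nrm M) + Real.log (nrm N) := by
  rw [← Real.log_mul (nrm_pos M).ne' (nrm_pos N).ne']
  exact Real.log_le_log (nrm_pos _) (nrm_mul M N)

lemma Lg_sub (n m : ℕ) (T : ℕ → SL2) : Lg (n + m) T ≤ Lg n T + Lg m (sh^[n] T) := by
  rw [Lg, Pprod_add, add_comm (Lg n T)]
  exact log_nrm_mul _ _

lemma Lg_inv (n : ℕ) (T : ℕ → SL2) : Lg n (sh T) ≤ Lg (n + 1) T + Real.log (nrm (T 1)⁻¹) := by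
  have : Pprod (sh T) n = Pprod T (n + 1) * (T 1)⁻¹ := by
    rw [add_comm, Pprod_add, Pprod_one]
    simp
  rw [Lg, this]
  exact log_nrm_mul _ _

section prob
variable (ν : Measure SL2) [IsProbabilityMeasure ν] (μ : Measure (ℕ → SL2)) [IsProbabilityMeasure μ]
    (hμ : ∀ (s : Finset ℕ) (A : ℕ → Set SL2), (∀ i, MeasurableSet (A i)) →
      μ {T | ∀ i ∈ s, T i ∈ A i} = ∏ i ∈ s, ν (A i))

lemma mu_unique (μ₁ : Measure (ℕ → SL2))
    (h1 : ∀ (s : Finset ℕ) (A : ℕ → Set SL2), (∀ i, MeasurableSet (A i)) →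
      μ₁ {T | ∀ i ∈ s, T i ∈ A i} = ∏ i ∈ s, ν (A i))  :
    μ₁ = Measure.infinitePi (fun _ => ν) := by
  apply Measure.eq_infinitePi
  intro s t ht
  classical
  have := h1 s (fun i => if i ∈ s then t i else Set.univ)
    (fun i => by by_cases hi : i ∈ s <;> simp [hi, ht])
  rw [Finset.prod_congr rfl (g := fun i => ν (t i)) (fun i hi => by simp [hi])] at this
  rw [← this]
  congr 1
  ext T
  simp only [Set.mem_pi, Finset.mem_coe, Set.mem_ofPred_eq]
  refine forall₂_congr fun i hi => by simp [hi]

include hμ in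
lemma sh_mp : MeasurePreserving sh μ μ := by
  refine ⟨sh_measurable, ?_⟩
  rw [mu_unique ν μ hμ]
  refine mu_unique ν _ ?_
  intro s A hA
  rw [Measure.map_apply sh_measurable]
  swap
  · have : {T : ℕ → SL2 | ∀ i ∈ s, T i ∈ A i} = ⋂ i ∈ s, (fun T => T i) ⁻¹' A i := by
      ext; simp
    rw [this]
    exact Finset.measurableSet_biInter _ fun i _ => measurable_pi_apply i (hA i)
  rw [← mu_unique ν μ hμ]
  have := hμ (s.map ⟨fun i => i + 1, fun a b h => by simpa using h⟩) (fun i => A (i - 1))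
    (fun i => hA _)
  rw [Finset.prod_map] at this
  refine Eq.trans ?_ this
  congr 1
  ext T
  simp [sh]
  rfl

include hμ in
lemma coord_mp (i : ℕ) : MeasurePreserving (fun T : ℕ → SL2 => T i) μ ν := by
  refine ⟨measurable_pi_apply i, ?_⟩
  ext A hA
  rw [Measure.map_apply (measurable_pi_apply i) hA]
  have := hμ {i} (fun _ => A) (fun _ => hA)
  simp only [Finset.mem_singleton, forall_eq, Finset.prod_singleton] at this
  exact this

include hμ in
lemma coord_indep : ProbabilityTheory.iIndepFun (fun (i : ℕ) (T : ℕ → SL2) => T i) μ := by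
  rw [mu_unique ν μ hμ]
  exact ProbabilityTheory.iIndepFun_infinitePi (X := fun _ x => x) (fun i => measurable_id)

/-- extend a partial tuple by `1`. -/
def ext1 (S : Finset ℕ) (x : S → SL2) : ℕ → SL2 := fun i => if h : i ∈ S then x ⟨i, h⟩ else 1

lemma ext1_measurable (S : Finset ℕ) : Measurable (ext1 S) := by
  refine measurable_pi_lambda _ fun i => ?_
  by_cases h : i ∈ S
  · simp only [ext1, h, dite_true]; exact measurable_pi_apply _
  · simp only [ext1, h, dite_false]; exact measurable_const

include hμ in
lemma indep_finset {α β : Type*} [MeasurableSpace α] [MeasurableSpace β] (S S' : Finset ℕ)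
    (hS : Disjoint S S') (f : (ℕ → SL2) → α) (g : (ℕ → SL2) → β) (hf : Measurable f)
    (hg : Measurable g) (hfS : ∀ T T', (∀ i ∈ S, T i = T' i) → f T = f T')
    (hgS : ∀ T T', (∀ i ∈ S', T i = T' i) → g T = g T') : ProbabilityTheory.IndepFun f g μ := by
  have h := (coord_indep ν μ hμ).indepFun_finset S S' hS (fun i => measurable_pi_apply i)
  have h2 := h.comp (hf.comp (ext1_measurable S)) (hg.comp (ext1_measurable S'))
  convert h2 using 1
  · ext T
    simp only [Function.comp]
    apply hfS
    intro i hi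
    simp [ext1, hi]
  · ext T
    simp only [Function.comp]
    apply hgS
    intro i hi
    simp [ext1, hi]

include hμ in
lemma lln_blocks (k : ℕ) (hint : Integrable (Lg k) μ) : ∀ᵐ T ∂μ,
      Tendsto (fun m : ℕ => (∑ j ∈ Finset.range m, Lg k (sh^[j * k] T)) / m) atTop
        (nhds (∫ T, Lg k T ∂μ)) := by
  have hsi : ∀ i, MeasurePreserving sh^[i] μ μ := fun i => (sh_mp ν μ hμ).iterate i
  have := ProbabilityTheory.strong_law_ae_real (μ := μ) (fun j T => Lg k (sh^[j * k] T))
    (by simpa using hint) ?_ ?_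
  · simpa using this
  · have key : ∀ i j : ℕ, i < j → ProbabilityTheory.IndepFun (fun T => Lg k (sh^[i * k] T))
        (fun T => Lg k (sh^[j * k] T)) μ := by
      intro i j hij
      have hd : ∀ i T T', (∀ a ∈ Finset.Ioc (i * k) (i * k + k), T a = T' a) →
          Lg k (sh^[i * k] T) = Lg k (sh^[i * k] T') := by
        intro i T T' h
        simp only [Lg]
        congr 2
        apply Pprod_congr
        intro a h1 h2
        rw [sh_iter, sh_iter]
        apply h
        simp; omega
      refine indep_finset ν μ hμ (Finset.Ioc (i * k) (i * k + k)) (Finset.Ioc (j * k) (j * k + k))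
        ?_ _ _ ((Lg_measurable k).comp (hsi _).measurable) ((Lg_measurable k).comp (hsi _).measurable)
        (hd i) (hd j)
      rw [Finset.disjoint_left]
      intro a ha hb
      simp only [Finset.mem_Ioc] at ha hb
      have : (i + 1) * k ≤ j * k := Nat.mul_le_mul_right _ hij
      rw [Nat.succ_mul] at this
      omega
    intro i j hij
    rcases lt_or_gt_of_ne hij with h | h
    · exact key i j h
    · exact (key j i h).symm
  · intro i
    refine ⟨((Lg_measurable k).comp (hsi _).measurable).aemeasurable,
      ((Lg_measurable k).comp (hsi _).measurable).aemeasurable, ?_⟩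
    have e : ∀ i, Measure.map (fun T => Lg k (sh^[i * k] T)) μ = Measure.map (Lg k) μ := by
      intro i
      have : (fun T => Lg k (sh^[i * k] T)) = Lg k ∘ sh^[i * k] := rfl
      rw [this, ← Measure.map_map (Lg_measurable k) (hsi _).measurable, (hsi _).map_eq]
    rw [e, e]

include hμ in
lemma Lg_one_integrable (hlog : ∫⁻ M : SL2, ENNReal.ofReal (Real.log (nrm M)) ∂ν < ⊤) :
    Integrable (Lg 1) μ := by
  have hm : Measurable fun M : SL2 => Real.log (nrm M) :=
    Real.measurable_log.comp nrm_continuous.measurable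
  have h1 : Integrable (fun M : SL2 => Real.log (nrm M)) ν := by
    refine ⟨hm.aestronglyMeasurable, ?_⟩
    rw [hasFiniteIntegral_iff_ofReal (Eventually.of_forall fun M => Real.log_nonneg (nrm_ge_one M))]
    exact hlog
  have := (coord_mp ν μ hμ 1).integrable_comp_of_integrable h1
  refine this.congr (Eventually.of_forall fun T => ?_)
  simp [Lg, Pprod_one]

include hμ in
lemma furst_limit (hlog : ∫⁻ M : SL2, ENNReal.ofReal (Real.log (nrm M)) ∂ν < ⊤) :
    ∃ γ : ℝ, Tendsto (fun n : ℕ => (∫ T, Lg n T ∂μ) / n) atTop (nhds γ) ∧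
      ∀ᵐ T ∂μ, Tendsto (fun n : ℕ => Lg n T / n) atTop (nhds γ) :=
  subadd_ergodic μ sh (sh_mp ν μ hμ) Lg Lg_measurable Lg_nonneg Lg_zero Lg_sub
    (Lg_one_integrable ν μ hμ hlog) (fun T => Real.log (nrm (T 1)⁻¹)) Lg_inv
    (fun k _ hk => lln_blocks ν μ hμ k hk)

end prob

/-- the plane -/
abbrev E2 := EuclideanSpace ℝ (Fin 2)

lemma lact_det (M : SL2) : LinearMap.det (lact M : E2 →ₗ[ℝ] E2) = 1 := by
  rw [lact, Matrix.coe_toEuclideanCLM_eq_toEuclideanLin,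
    Matrix.toEuclideanLin_eq_toLin_orthonormal, LinearMap.det_toLin]
  exact M.prop

lemma lact_mp (M : SL2) : MeasurePreserving (lact M) (volume : Measure E2) volume := by
  refine ⟨(lact M).continuous.measurable, ?_⟩
  have := Measure.map_linearMap_addHaar_eq_smul_addHaar (volume : Measure E2)
    (f := (lact M : E2 →ₗ[ℝ] E2)) (by rw [lact_det]; norm_num)
  rw [lact_det] at this
  simpa using this

lemma lact_joint : Continuous (fun p : SL2 × E2 => lact p.1 p.2) :=
  (lact_continuous.comp continuous_fst).clm_apply continuous_snd

lemma lact_joint' : Measurable (fun p : E2 × SL2 => lact p.2 p.1) :=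
  ((lact_continuous.comp continuous_snd).clm_apply continuous_fst).measurable

lemma lact_left (x : E2) : Measurable (fun M : SL2 => lact M x) :=
  (lact_continuous.clm_apply continuous_const).measurable

/-- the averaging operator -/
def avg (ν : Measure SL2) (f : E2 → ENNReal) (x : E2) : ENNReal := ∫⁻ M, f (lact M x) ∂ν

lemma ennreal_amgm (a b K : ENNReal) (hK : K ≠ 0) (hK' : K ≠ ⊤) :
    a * b ≤ K * a ^ 2 + K⁻¹ * b ^ 2 := by
  rcases le_total b (K * a) with h | h
  · calc a * b ≤ a * (K * a) := by gcongr
      _ = K * a ^ 2 := by ring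
      _ ≤ _ := le_self_add
  · have h2 : a ≤ K⁻¹ * b := by
      calc a = K⁻¹ * (K * a) := by rw [← mul_assoc, ENNReal.inv_mul_cancel hK hK', one_mul]
        _ ≤ _ := by gcongr
    calc a * b ≤ (K⁻¹ * b) * b := by gcongr
      _ = K⁻¹ * b ^ 2 := by ring
      _ ≤ _ := le_add_self

lemma ennreal_add_sq (a b : ENNReal) : (a + b) ^ 2 ≤ 4 * a ^ 2 + 4 * b ^ 2 := by
  rcases le_total a b with h | h
  · calc (a + b) ^ 2 ≤ (b + b) ^ 2 := by gcongr
      _ = 4 * b ^ 2 := by ring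
      _ ≤ _ := le_add_self
  · calc (a + b) ^ 2 ≤ (a + a) ^ 2 := by gcongr
      _ = 4 * a ^ 2 := by ring
      _ ≤ _ := le_self_add

section
variable (ν : Measure SL2) [IsProbabilityMeasure ν]

lemma avg_meas (f : E2 → ENNReal) (hf : Measurable f) : Measurable (avg ν f) := by
  have : Measurable (fun p : E2 × SL2 => f (lact p.2 p.1)) :=
    hf.comp lact_joint'
  exact this.lintegral_prod_right'

lemma avg_mono (f g : E2 → ENNReal) (h : f ≤ g) : avg ν f ≤ avg ν g :=
  fun _ => lintegral_mono fun _ => h _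

lemma avg_smul (c : ENNReal) (f : E2 → ENNReal) (hf : Measurable f) :
    avg ν (fun x => c * f x) = fun x => c * avg ν f x := by
  ext x
  simp only [avg]
  rw [lintegral_const_mul]
  exact hf.comp (lact_left x)

lemma sq_lintegral_le (h : SL2 → ENNReal) (hh : Measurable h) :
    (∫⁻ M, h M ∂ν) ^ 2 ≤ ∫⁻ M, h M ^ 2 ∂ν := by
  have := ENNReal.lintegral_mul_le_Lp_mul_Lq ν Real.HolderConjugate.two_two hh.aemeasurable
    (g := fun _ => 1) aemeasurable_const
  simp only [Pi.mul_apply, mul_one, ENNReal.one_rpow, lintegral_const, measure_univ] at this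
  calc (∫⁻ M, h M ∂ν) ^ 2 ≤ ((∫⁻ M, h M ^ (2 : ℝ) ∂ν) ^ (1 / 2 : ℝ)) ^ 2 := by gcongr
    _ = ∫⁻ M, h M ^ 2 ∂ν := by
      rw [← ENNReal.rpow_natCast, ← ENNReal.rpow_mul]
      simp

lemma avg_sq (f : E2 → ENNReal) (hf : Measurable f) : ∫⁻ x, avg ν f x ^ 2 ≤ ∫⁻ x, f x ^ 2 := by
  calc ∫⁻ x, avg ν f x ^ 2 ≤ ∫⁻ x, (∫⁻ M, f (lact M x) ^ 2 ∂ν) := by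
        refine lintegral_mono fun x => sq_lintegral_le ν _ ?_
        exact hf.comp (lact_left x)
    _ = ∫⁻ M, (∫⁻ x, f (lact M x) ^ 2) ∂ν := by
        refine lintegral_lintegral_swap ?_
        exact ((hf.comp lact_joint').pow_const 2).aemeasurable
    _ = ∫⁻ M, (∫⁻ x, f x ^ 2) ∂ν := by
        refine lintegral_congr fun M => ?_
        exact (lact_mp M).lintegral_comp (hf.pow_const 2)
    _ = _ := by simp

/-- partial sums of the resolvent series -/
def rsum (s : ENNReal) (f : E2 → ENNReal) : ℕ → E2 → ENNReal
  | 0 => 0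
  | n + 1 => fun x => f x + s * avg ν (rsum s f n) x

lemma rsum_meas (s : ENNReal) (f : E2 → ENNReal) (hf : Measurable f) (n : ℕ) :
    Measurable (rsum ν s f n) := by
  induction n with
  | zero => exact measurable_const
  | succ n ih => exact hf.add ((avg_meas ν _ ih).const_mul _)

lemma rsum_mono (s : ENNReal) (f : E2 → ENNReal) (n : ℕ) :
    rsum ν s f n ≤ rsum ν s f (n + 1) := by
  induction n with
  | zero => intro x; exact bot_le
  | succ n ih =>
    intro x
    change f x + s * avg ν (rsum ν s f n) x ≤ f x + s * avg ν (rsum ν s f (n + 1)) x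
    gcongr
    exact avg_mono ν _ _ ih x

lemma rsum_sq (s : ENNReal) (hs : s ≠ ⊤) (f : E2 → ENNReal) (hf : Measurable f)
    (hf2 : ∫⁻ x, f x ^ 2 ≠ ⊤) (n : ℕ) : ∫⁻ x, rsum ν s f n x ^ 2 ≠ ⊤ := by
  induction n with
  | zero => simp [rsum]
  | succ n ih =>
    have h1 : ∫⁻ x, rsum ν s f (n + 1) x ^ 2 ≤
        4 * (∫⁻ x, f x ^ 2) + 4 * s ^ 2 * ∫⁻ x, rsum ν s f n x ^ 2 := by
      calc _ ≤ ∫⁻ x, (4 * f x ^ 2 + (4 * s ^ 2) * avg ν (rsum ν s f n) x ^ 2) := by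
            refine lintegral_mono fun x => ?_
            refine (ennreal_add_sq _ _).trans (le_of_eq ?_)
            ring
        _ = 4 * (∫⁻ x, f x ^ 2) + 4 * s ^ 2 * ∫⁻ x, avg ν (rsum ν s f n) x ^ 2 := by
            rw [lintegral_add_left ((hf.pow_const 2).const_mul _),
              lintegral_const_mul _ (hf.pow_const 2),
              lintegral_const_mul _ ((avg_meas ν _ (rsum_meas ν s f hf n)).pow_const 2)]
        _ ≤ _ := by
            exact add_le_add le_rfl (mul_le_mul_right (avg_sq ν _ (rsum_meas ν s f hf n)) _)
    refine ne_top_of_le_ne_top ?_ h1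
    refine ENNReal.add_ne_top.2 ⟨ENNReal.mul_ne_top (by simp) hf2, ENNReal.mul_ne_top ?_ ih⟩
    exact ENNReal.mul_ne_top (by simp) (ENNReal.pow_ne_top hs)

lemma pow_avg_le_rsum (s : ENNReal) (f : E2 → ENNReal) (hf : Measurable f) (n : ℕ) :
    Measurable ((avg ν)^[n] f) ∧ ∀ x, s ^ n * (avg ν)^[n] f x ≤ rsum ν s f (n + 1) x := by
  induction n with
  | zero => exact ⟨hf, fun x => by simp [rsum]⟩
  | succ n ih =>
    rw [Function.iterate_succ_apply']
    refine ⟨avg_meas ν _ ih.1, fun x => ?_⟩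
    calc s ^ (n + 1) * avg ν ((avg ν)^[n] f) x
        = s * (fun x => s ^ n * avg ν ((avg ν)^[n] f) x) x := by ring
      _ = s * avg ν (fun x => s ^ n * (avg ν)^[n] f x) x := by rw [avg_smul ν _ _ ih.1]
      _ ≤ s * avg ν (rsum ν s f (n + 1)) x := by
          gcongr
          exact avg_mono ν _ _ ih.2 x
      _ ≤ _ := le_add_self

lemma decay (q : NNReal) (hq : q < 1)
    (hA : ∀ f : E2 → ENNReal, Measurable f → ∫⁻ x, f x ^ 2 ≠ ⊤ →
      ∫⁻ x, f x * avg ν f x ≤ q * ∫⁻ x, f x ^ 2)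
    (f : E2 → ENNReal) (hf : Measurable f) (hf2 : ∫⁻ x, f x ^ 2 ≠ ⊤) :
    ∃ s : NNReal, 1 < s ∧ ∃ K : ENNReal, K ≠ ⊤ ∧
      ∀ n, (s : ENNReal) ^ n * ∫⁻ x, f x * (avg ν)^[n] f x ≤ K := by
  have hq' : (q : ℝ) < 1 := by exact_mod_cast hq
  have hq0 : (0 : ℝ) ≤ q := q.2
  set s : NNReal := 2 / (1 + q) with hs
  have hs1 : 1 < s := by
    rw [hs, lt_div_iff₀ (by positivity), one_mul, ← one_add_one_eq_two]
    exact (add_lt_add_iff_left 1).2 hq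
  let c : ℝ := (1 - q) / (1 + q)
  have hc : 0 < c := div_pos (by linarith) (by linarith)
  have hsq : (s : ℝ) * q = 1 - c := by
    simp only [hs, c]; push_cast; field_simp; ring
  let K : NNReal := ⟨2 / c, by positivity⟩
  have hKpos : 0 < (K : ℝ) := by simp only [K]; change 0 < 2 / c; positivity
  have hK0 : (K : ENNReal) ≠ 0 := by
    intro h; rw [ENNReal.coe_eq_zero] at h; rw [h] at hKpos; simp at hKpos
  set C0 := ∫⁻ x, f x ^ 2 with hC0
  have hbound : ∀ n, ∫⁻ x, rsum ν s f n x ^ 2 ≤ ENNReal.ofReal (4 * C0.toReal / c ^ 2) := by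
    intro n
    set F := rsum ν s f n with hF
    have hFm : Measurable F := rsum_meas ν s f hf n
    have hFfin : ∫⁻ x, F x ^ 2 ≠ ⊤ := rsum_sq ν s (by simp) f hf hf2 n
    set D := ∫⁻ x, F x ^ 2 with hD
    have hfF : Measurable fun x => f x * F x := hf.mul hFm
    have h1 : D ≤ (∫⁻ x, f x * F x) + s * ∫⁻ x, F x * avg ν F x := by
      calc D ≤ ∫⁻ x, (f x * F x + s * (F x * avg ν F x)) := by
            refine lintegral_mono fun x => ?_
            have := rsum_mono ν s f n x
            change F x ≤ f x + s * avg ν F x at this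
            calc F x ^ 2 = F x * F x := by ring
              _ ≤ F x * (f x + s * avg ν F x) := by gcongr
              _ = _ := by ring
        _ = _ := by
            rw [lintegral_add_left hfF, lintegral_const_mul]
            exact hFm.mul (avg_meas ν _ hFm)
    have h2 : ∫⁻ x, f x * F x ≤ K * C0 + (K : ENNReal)⁻¹ * D := by
      calc _ ≤ ∫⁻ x, (K * f x ^ 2 + (K : ENNReal)⁻¹ * F x ^ 2) :=
            lintegral_mono fun x => ennreal_amgm _ _ _ hK0 (by simp)
        _ = _ := by
            rw [lintegral_add_left ((hf.pow_const 2).const_mul _),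
              lintegral_const_mul _ (hf.pow_const 2), lintegral_const_mul _ (hFm.pow_const 2)]
    have h3 : D ≤ K * C0 + (K : ENNReal)⁻¹ * D + s * (q * D) := by
      refine h1.trans (add_le_add h2 ?_)
      gcongr
      exact hA F hFm hFfin
    have h4 : D.toReal ≤ (2 / c) * C0.toReal + (c / 2) * D.toReal + (1 - c) * D.toReal := by
      have hKi : (K : ENNReal)⁻¹ ≠ ⊤ := ENNReal.inv_ne_top.2 hK0
      have := ENNReal.toReal_mono (by
        refine ENNReal.add_ne_top.2 ⟨ENNReal.add_ne_top.2 ⟨ENNReal.mul_ne_top (by simp) hf2,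
          ENNReal.mul_ne_top hKi hFfin⟩, ENNReal.mul_ne_top (by simp)
            (ENNReal.mul_ne_top (by simp) hFfin)⟩) h3
      rw [ENNReal.toReal_add (ENNReal.add_ne_top.2 ⟨ENNReal.mul_ne_top (by simp) hf2,
          ENNReal.mul_ne_top hKi hFfin⟩) (ENNReal.mul_ne_top (by simp)
            (ENNReal.mul_ne_top (by simp) hFfin)), ENNReal.toReal_add
            (ENNReal.mul_ne_top (by simp) hf2) (ENNReal.mul_ne_top hKi hFfin)] at this
      simp only [ENNReal.toReal_mul, ENNReal.toReal_inv, ENNReal.coe_toReal] at this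
      rw [← mul_assoc, hsq] at this
      have e1 : (K : ℝ) = 2 / c := rfl
      rw [e1, inv_div] at this
      exact this
    rw [← ENNReal.ofReal_toReal hFfin]
    refine ENNReal.ofReal_le_ofReal ?_
    rw [le_div_iff₀ (by positivity)]
    have h5 : c / 2 * D.toReal ≤ 2 / c * C0.toReal := by linarith
    have h6 := mul_le_mul_of_nonneg_left h5 (by positivity : 0 ≤ 2 * c)
    calc D.toReal * c ^ 2 = 2 * c * (c / 2 * D.toReal) := by ring
      _ ≤ _ := h6
      _ = 4 * C0.toReal := by field_simp; ring
  refine ⟨s, hs1, C0 + ENNReal.ofReal (4 * C0.toReal / c ^ 2), by simp [hf2], fun n => ?_⟩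
  have hp := pow_avg_le_rsum ν s f hf n
  have hfp : Measurable fun x => f x * (avg ν)^[n] f x := hf.mul hp.1
  calc (s : ENNReal) ^ n * ∫⁻ x, f x * (avg ν)^[n] f x
      = ∫⁻ x, f x * (s ^ n * (avg ν)^[n] f x) := by
        rw [← lintegral_const_mul _ hfp]
        refine lintegral_congr fun x => by ring
    _ ≤ ∫⁻ x, f x * rsum ν s f (n + 1) x := by
        refine lintegral_mono fun x => ?_
        gcongr
        exact hp.2 x
    _ ≤ ∫⁻ x, (1 * f x ^ 2 + 1⁻¹ * rsum ν s f (n + 1) x ^ 2) :=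
        lintegral_mono fun x => ennreal_amgm _ _ 1 (by simp) (by simp)
    _ = C0 + ∫⁻ x, rsum ν s f (n + 1) x ^ 2 := by
        simp only [inv_one, one_mul]
        rw [lintegral_add_left (hf.pow_const 2)]
    _ ≤ _ := by gcongr; exact hbound _

end

section prob
variable (ν : Measure SL2) [IsProbabilityMeasure ν] (μ : Measure (ℕ → SL2)) [IsProbabilityMeasure μ]
    (hμ : ∀ (s : Finset ℕ) (A : ℕ → Set SL2), (∀ i, MeasurableSet (A i)) →
      μ {T | ∀ i ∈ s, T i ∈ A i} = ∏ i ∈ s, ν (A i))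

include hμ in
lemma avg_iter (n : ℕ) (f : E2 → ENNReal) (hf : Measurable f) (x : E2) :
    (avg ν)^[n] f x = ∫⁻ T, f (lact (Pprod T n) x) ∂μ := by
  induction n generalizing f with
  | zero => simp [Pprod, lact_one_apply]
  | succ n ih =>
    rw [Function.iterate_succ_apply, ih _ (avg_meas ν f hf)]
    have hP := Pprod_measurable n
    have hi : ProbabilityTheory.IndepFun (fun T : ℕ → SL2 => T (n + 1)) (fun T => Pprod T n) μ := by
      refine indep_finset ν μ hμ {n + 1} (Finset.Icc 1 n) (by simp) _ _ (measurable_pi_apply _) hP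
        (fun T T' h => h _ (by simp)) (fun T T' h => Pprod_congr n T T' ?_)
      intro i h1 h2
      exact h i (by simp [h1, h2])
    rw [ProbabilityTheory.indepFun_iff_map_prod_eq_prod_map_map
      (measurable_pi_apply _).aemeasurable hP.aemeasurable, (coord_mp ν μ hμ (n + 1)).map_eq] at hi
    have : IsProbabilityMeasure (Measure.map (fun T => Pprod T n) μ) :=
      Measure.isProbabilityMeasure_map hP.aemeasurable
    have hin : Measurable (fun p : SL2 × SL2 => lact p.1 (lact p.2 x)) :=
      ((lact_continuous.comp continuous_fst).clm_apply
        ((lact_continuous.comp continuous_snd).clm_apply continuous_const)).measurable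
    have hg : Measurable (fun p : SL2 × SL2 => f (lact p.1 (lact p.2 x))) := hf.comp hin
    symm
    calc ∫⁻ T, f (lact (Pprod T (n + 1)) x) ∂μ
        = ∫⁻ T, (fun p : SL2 × SL2 => f (lact p.1 (lact p.2 x))) (T (n + 1), Pprod T n) ∂μ := by
          refine lintegral_congr fun T => ?_
          simp only [Pprod, lact_mul_apply]
      _ = ∫⁻ p, f (lact p.1 (lact p.2 x)) ∂(ν.prod (Measure.map (fun T => Pprod T n) μ)) := by
          rw [← hi, lintegral_map hg ((measurable_pi_apply _).prodMk hP)]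
      _ = ∫⁻ N, avg ν f (lact N x) ∂(Measure.map (fun T => Pprod T n) μ) := by
          rw [lintegral_prod_symm' _ hg]
          rfl
      _ = _ := by
          have h5 : Measurable fun N : SL2 => avg ν f (lact N x) :=
            (avg_meas ν f hf).comp (lact_left x)
          rw [lintegral_map h5 hP]

include hμ in
lemma Lg_integrable (hlog : ∫⁻ M : SL2, ENNReal.ofReal (Real.log (nrm M)) ∂ν < ⊤) (n : ℕ) :
    Integrable (Lg n) μ := by
  induction n with
  | zero =>
    have : Lg 0 = fun _ => 0 := by ext T; exact Lg_zero T
    rw [this]; exact integrable_zero _ _ _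
  | succ n ih =>
    have h1 := Lg_one_integrable ν μ hμ hlog
    have h2 : Integrable (Lg 1 ∘ sh^[n]) μ :=
      ((sh_mp ν μ hμ).iterate n).integrable_comp_of_integrable h1
    refine (ih.add h2).mono' (Lg_measurable _).aestronglyMeasurable (Eventually.of_forall fun T => ?_)
    rw [Real.norm_of_nonneg (Lg_nonneg _ _)]
    exact Lg_sub n 1 T

lemma ball_lower (M : SL2) :
    ENNReal.ofReal (Real.exp (-2 * Real.log (nrm M))) * volume (Metric.ball (0 : E2) 1) ≤
    ∫⁻ x, (Metric.ball (0 : E2) 1).indicator 1 x * (Metric.ball (0 : E2) 1).indicator 1 (lact M x) := by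
  have hM := nrm_pos M
  have hM1 := nrm_ge_one M
  have e : Real.exp (-2 * Real.log (nrm M)) = (1 / nrm M) ^ Module.finrank ℝ E2 := by
    rw [finrank_euclideanSpace_fin, neg_mul, Real.exp_neg, mul_comm, Real.exp_mul, Real.exp_log hM]
    simp
  rw [e, ← Measure.addHaar_ball volume (0 : E2) (by positivity), ← lintegral_indicator_one
    Metric.isOpen_ball.measurableSet]
  refine lintegral_mono fun x => ?_
  by_cases hx : x ∈ Metric.ball (0 : E2) (1 / nrm M)
  · have hx' : ‖x‖ < 1 / nrm M := by simpa using hx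
    have a1 : x ∈ Metric.ball (0 : E2) 1 := by
      simp only [Metric.mem_ball, dist_zero_right]
      refine hx'.trans_le ?_
      rw [div_le_one hM]; exact hM1
    have a2 : lact M x ∈ Metric.ball (0 : E2) 1 := by
      simp only [Metric.mem_ball, dist_zero_right]
      calc ‖lact M x‖ ≤ nrm M * ‖x‖ := (lact M).le_opNorm x
        _ < nrm M * (1 / nrm M) := by gcongr
        _ = 1 := by field_simp
    rw [Set.indicator_of_mem hx, Set.indicator_of_mem a1, Set.indicator_of_mem a2]
    simp
  · rw [Set.indicator_of_notMem hx]
    exact bot_le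

include hμ in
lemma corr_swap (n : ℕ) (f : E2 → ENNReal) (hfm : Measurable f) :
    ∫⁻ T, (∫⁻ x, f x * f (lact (Pprod T n) x)) ∂μ = ∫⁻ x, f x * (avg ν)^[n] f x := by
  have h3 : Measurable (fun p : (ℕ → SL2) × E2 => lact (Pprod p.1 n) p.2) := by
    have h4 : Measurable (fun p : (ℕ → SL2) × E2 => (p.2, Pprod p.1 n)) :=
      measurable_snd.prodMk ((Pprod_measurable n).comp measurable_fst)
    have h5 := lact_joint'.comp h4
    simp only [Function.comp_def] at h5
    exact h5
  have h6 : Measurable (fun p : (ℕ → SL2) × E2 => f (lact (Pprod p.1 n) p.2)) := hfm.comp h3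
  have h7 : Measurable (fun p : (ℕ → SL2) × E2 => f p.2) := hfm.comp measurable_snd
  have h8 : Measurable (fun p : (ℕ → SL2) × E2 => f p.2 * f (lact (Pprod p.1 n) p.2)) := h7.mul h6
  rw [lintegral_lintegral_swap h8.aemeasurable]
  refine lintegral_congr fun x => ?_
  have h9 : Measurable (fun T : ℕ → SL2 => f (lact (Pprod T n) x)) := by
    have h5 := (hfm.comp (lact_left x)).comp (Pprod_measurable n)
    simp only [Function.comp_def] at h5
    exact h5
  rw [avg_iter ν μ hμ n f hfm x, lintegral_const_mul _ h9]

include hμ in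
lemma gamma_pos (hlog : ∫⁻ M : SL2, ENNReal.ofReal (Real.log (nrm M)) ∂ν < ⊤)
    (q : NNReal) (hq : q < 1)
    (hA : ∀ f : E2 → ENNReal, Measurable f → ∫⁻ x, f x ^ 2 ≠ ⊤ →
      ∫⁻ x, f x * avg ν f x ≤ q * ∫⁻ x, f x ^ 2) (γ : ℝ)
    (hγ : Tendsto (fun n : ℕ => (∫ T, Lg n T ∂μ) / n) atTop (nhds γ)) : 0 < γ := by
  set V := volume (Metric.ball (0 : E2) 1) with hV
  have hV0 : 0 < V := Metric.measure_ball_pos _ _ one_pos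
  have hVt : V ≠ ⊤ := measure_ball_lt_top.ne
  set f : E2 → ENNReal := (Metric.ball (0 : E2) 1).indicator 1 with hf
  have hfm : Measurable f := measurable_one.indicator Metric.isOpen_ball.measurableSet
  have hf2 : ∫⁻ x, f x ^ 2 ≠ ⊤ := by
    have : ∀ x, f x ^ 2 = f x := by
      intro x
      simp only [hf, Set.indicator]; split_ifs <;> simp
    simp only [this]
    rw [hf, lintegral_indicator_one Metric.isOpen_ball.measurableSet]
    exact hVt
  obtain ⟨s, hs1, K, hK, hdec⟩ := decay ν q hq hA f hfm hf2
  have hs1' : (1 : ℝ) < s := by exact_mod_cast hs1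
  have hlow : ∀ n : ℕ, (s : ENNReal) ^ n * (ENNReal.ofReal (Real.exp (-2 * ∫ T, Lg n T ∂μ)) * V) ≤ K := by
    intro n
    refine le_trans ?_ (hdec n)
    refine mul_le_mul_right ?_ _
    have hi := Lg_integrable ν μ hμ hlog n
    set a := ∫ T, Lg n T ∂μ with ha
    have hexpm : Measurable fun T => Real.exp (-2 * Lg n T) :=
      ((Lg_measurable n).const_mul _).exp
    have hexp : Integrable (fun T => Real.exp (-2 * Lg n T)) μ := by
      refine Integrable.mono' (integrable_const 1) hexpm.aestronglyMeasurable
        (Eventually.of_forall fun T => ?_)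
      rw [Real.norm_of_nonneg (Real.exp_pos _).le, Real.exp_le_one_iff]
      have := Lg_nonneg n T
      linarith
    have hs : Integrable (fun T => Lg n T - a) μ := hi.sub (integrable_const a)
    have hJ : Real.exp (-2 * a) ≤ ∫ T, Real.exp (-2 * Lg n T) ∂μ := by
      have h1 : ∫ T, Real.exp (-2 * a) * (1 + (-2) * (Lg n T - a)) ∂μ = Real.exp (-2 * a) := by
        rw [integral_const_mul, integral_add (integrable_const _)
          (hs.const_mul _), integral_const_mul,
          integral_sub hi (integrable_const a)]
        simp [← ha]
      rw [← h1]
      refine integral_mono (((integrable_const _).add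
          (hs.const_mul _)).const_mul _) hexp fun T => ?_
      have h2 : Real.exp (-2 * Lg n T) = Real.exp (-2 * a) * Real.exp (-2 * (Lg n T - a)) := by
        rw [← Real.exp_add]; congr 1; ring
      simp only
      rw [h2]
      refine mul_le_mul_of_nonneg_left ?_ (Real.exp_pos _).le
      have := Real.add_one_le_exp (-2 * (Lg n T - a))
      linarith
    calc ENNReal.ofReal (Real.exp (-2 * a)) * V
        ≤ ENNReal.ofReal (∫ T, Real.exp (-2 * Lg n T) ∂μ) * V := by gcongr
      _ = (∫⁻ T, ENNReal.ofReal (Real.exp (-2 * Lg n T)) ∂μ) * V := by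
          rw [ofReal_integral_eq_lintegral_ofReal hexp
            (Eventually.of_forall fun T => (Real.exp_pos _).le)]
      _ = ∫⁻ T, ENNReal.ofReal (Real.exp (-2 * Lg n T)) * V ∂μ := by
          rw [lintegral_mul_const _ hexpm.ennreal_ofReal]
      _ ≤ ∫⁻ T, (∫⁻ x, f x * f (lact (Pprod T n) x)) ∂μ :=
          lintegral_mono fun T => ball_lower (Pprod T n)
      _ = ∫⁻ x, f x * (avg ν)^[n] f x := corr_swap ν μ hμ n f hfm
  set C := K.toReal / V.toReal + 1 with hC
  have hVr : 0 < V.toReal := ENNReal.toReal_pos hV0.ne' hVt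
  have hCpos : 0 < C := by positivity
  have hreal : ∀ n : ℕ, n * Real.log s - 2 * ∫ T, Lg n T ∂μ ≤ Real.log C := by
    intro n
    have := ENNReal.toReal_mono hK (hlow n)
    simp only [ENNReal.toReal_mul, ENNReal.toReal_pow, ENNReal.coe_toReal,
      ENNReal.toReal_ofReal (Real.exp_pos _).le] at this
    rw [← mul_assoc, ← le_div_iff₀ hVr] at this
    have h2 : (s : ℝ) ^ n * Real.exp (-2 * ∫ T, Lg n T ∂μ) ≤ C := this.trans (by linarith)
    have h3 := Real.log_le_log (by positivity) h2
    rw [Real.log_mul (by positivity) (Real.exp_pos _).ne', Real.log_pow, Real.log_exp] at h3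
    linarith
  have hls : 0 < Real.log s := Real.log_pos hs1'
  refine lt_of_lt_of_le (half_pos hls) ?_
  have hl : Tendsto (fun n : ℕ => Real.log s / 2 - Real.log C / 2 / n) atTop
      (nhds (Real.log s / 2 - 0)) :=
    tendsto_const_nhds.sub (tendsto_const_div_atTop_nhds_zero_nat _)
  rw [sub_zero] at hl
  refine le_of_tendsto_of_tendsto hl hγ ?_
  filter_upwards [eventually_gt_atTop 0] with n hn
  have hn' : (0 : ℝ) < n := by exact_mod_cast hn
  rw [le_div_iff₀ hn', sub_mul, div_mul_cancel₀ _ hn'.ne']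
  have := hreal n
  linarith

end prob

lemma lact_integral (M : SL2) (g : E2 → ℝ) (hg : Measurable g) :
    ∫ x, g (lact M x) = ∫ x, g x := by
  have h := (lact_mp M)
  rw [← integral_map (φ := lact M) (f := g) h.measurable.aemeasurable
    (by rw [h.map_eq]; exact hg.aestronglyMeasurable), h.map_eq]

lemma lact_meas (M : SL2) : Measurable (lact M : E2 → E2) := (lact M).continuous.measurable

section
variable (u : E2 → ℝ) (hu : Measurable u) (hi : Integrable (fun x => u x ^ 2))
  (h1 : ∫ x, u x ^ 2 = 1) (M : SL2)

include hu in
lemma uM_meas : Measurable fun x => u (lact M x) := hu.comp (lact_meas M)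

include hi in
lemma uM_int : Integrable fun x => u (lact M x) ^ 2 :=
  (lact_mp M).integrable_comp_of_integrable (g := fun x => u x ^ 2) hi

include hu h1 in
lemma uM_one : ∫ x, u (lact M x) ^ 2 = 1 := by
  rw [← h1]; exact lact_integral M (fun x => u x ^ 2) (hu.pow_const 2)

include hu hi in
lemma uuM_int : Integrable fun x => u x * u (lact M x) := by
  refine (hi.add (uM_int u hi M)).mono' (hu.mul (uM_meas u hu M)).aestronglyMeasurable
    (Eventually.of_forall fun x => ?_)
  simp only [Pi.add_apply]
  rw [Real.norm_eq_abs, abs_le]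
  constructor <;> nlinarith [sq_nonneg (u x - u (lact M x)), sq_nonneg (u x + u (lact M x)),
    sq_nonneg (u x), sq_nonneg (u (lact M x))]

include hu hi h1 in
lemma corr_le_one : ∫ x, u x * u (lact M x) ≤ 1 := by
  have h2 := uM_one u hu h1 M
  have hs : Integrable fun x => (u x ^ 2 + u (lact M x) ^ 2) / 2 := (hi.add (uM_int u hi M)).div_const 2
  calc ∫ x, u x * u (lact M x) ≤ ∫ x, (u x ^ 2 + u (lact M x) ^ 2) / 2 := by
        refine integral_mono (uuM_int u hu hi M) hs fun x => ?_
        simp only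
        nlinarith [sq_nonneg (u x - u (lact M x))]
    _ = 1 := by
        rw [integral_div, integral_add hi (uM_int u hi M), h1, h2]; norm_num

include hu hi h1 in
lemma corr_diff (ψ : E2 → ℝ) (hψ : Measurable ψ) (B : ℝ) (hB : ∀ x, |ψ x| ≤ B) (t : ℝ) (ht : 0 < t) :
    |(∫ x, ψ (lact M x) * u x ^ 2) - (∫ x, ψ x * u x ^ 2)| ≤
      B * ((1 - ∫ x, u x * u (lact M x)) / t + 2 * t) := by
  have hB0 : 0 ≤ B := (abs_nonneg _).trans (hB 0)
  have hψM : Measurable fun x => ψ (lact M x) := hψ.comp (lact_meas M)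
  have hiM := uM_int u hi M
  have hu1 := uM_one u hu h1 M
  have hc := uuM_int u hu hi M
  have e1 : ∫ x, ψ x * u x ^ 2 = ∫ x, ψ (lact M x) * u (lact M x) ^ 2 :=
    (lact_integral M (fun x => ψ x * u x ^ 2) (hψ.mul (hu.pow_const 2))).symm
  have i1 : Integrable fun x => ψ (lact M x) * u x ^ 2 :=
    hi.bdd_mul hψM.aestronglyMeasurable (c := B) (Eventually.of_forall fun x => hB _)
  have i2 : Integrable fun x => ψ (lact M x) * u (lact M x) ^ 2 :=
    hiM.bdd_mul hψM.aestronglyMeasurable (c := B) (Eventually.of_forall fun x => hB _)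
  rw [e1, ← integral_sub i1 i2]
  have i3 : Integrable fun x => (u x ^ 2 + u (lact M x) ^ 2) := hi.add hiM
  have i4 : Integrable fun x => (u x ^ 2 + u (lact M x) ^ 2) - 2 * (u x * u (lact M x)) :=
    i3.sub (hc.const_mul 2)
  have i5 : Integrable fun x => B * (((u x ^ 2 + u (lact M x) ^ 2) - 2 * (u x * u (lact M x))) / (2 * t)
      + t * (u x ^ 2 + u (lact M x) ^ 2)) := ((i4.div_const _).add (i3.const_mul t)).const_mul B
  have e2 : ∫ x, B * (((u x ^ 2 + u (lact M x) ^ 2) - 2 * (u x * u (lact M x))) / (2 * t)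
      + t * (u x ^ 2 + u (lact M x) ^ 2)) = B * ((1 - ∫ x, u x * u (lact M x)) / t + 2 * t) := by
    rw [integral_const_mul, integral_add (i4.div_const _) (i3.const_mul t), integral_div,
      integral_sub i3 (hc.const_mul 2), integral_const_mul, integral_const_mul,
      integral_add hi hiM, h1, hu1]
    field_simp
    ring
  rw [← e2, ← Real.norm_eq_abs]
  refine norm_integral_le_of_norm_le i5 (Eventually.of_forall fun x => ?_)
  rw [← mul_sub, Real.norm_eq_abs, abs_mul]
  refine mul_le_mul (hB _) ?_ (abs_nonneg _) hB0
  generalize u x = a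
  generalize u (lact M x) = b
  have key : ∀ a b : ℝ, a ^ 2 - b ^ 2 ≤ ((a ^ 2 + b ^ 2) - 2 * (a * b)) / (2 * t) + t * (a ^ 2 + b ^ 2) := by
    intro a b
    have h5 : ((a ^ 2 + b ^ 2) - 2 * (a * b)) / (2 * t) + t * (a ^ 2 + b ^ 2) - (a ^ 2 - b ^ 2) =
      ((a - b) - t * (a + b)) ^ 2 / (2 * t) + t * (a - b) ^ 2 / 2 := by
      field_simp; ring
    have : 0 ≤ ((a - b) - t * (a + b)) ^ 2 / (2 * t) + t * (a - b) ^ 2 / 2 := by positivity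
    linarith
  rw [abs_le]
  constructor
  · have := key b a
    rw [add_comm (b ^ 2), mul_comm b a] at this
    linarith
  · exact key a b

end

section
variable (ν : Measure SL2) [IsProbabilityMeasure ν]

/-- a single almost invariant function -/
lemma one_u (q : NNReal) (f : E2 → ENNReal) (hf : Measurable f) (hf2 : ∫⁻ x, f x ^ 2 ≠ ⊤)
    (hA : q * ∫⁻ x, f x ^ 2 < ∫⁻ x, f x * avg ν f x) :
    ∃ u : E2 → ℝ, Measurable u ∧ Integrable (fun x => u x ^ 2) ∧ ∫ x, u x ^ 2 = 1 ∧
      Measurable (fun M : SL2 => ∫ x, u x * u (lact M x)) ∧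
      ∫⁻ M, ENNReal.ofReal (1 - ∫ x, u x * u (lact M x)) ∂ν ≤ ENNReal.ofReal (1 - q) := by
  set N := ∫⁻ x, f x ^ 2 with hN
  have hN0 : N ≠ 0 := by
    intro h
    rw [hN, lintegral_eq_zero_iff (hf.pow_const 2)] at h
    have : ∫⁻ x, f x * avg ν f x = 0 := by
      have hmu : Measurable fun x => f x * avg ν f x := hf.mul (avg_meas ν f hf)
      rw [lintegral_eq_zero_iff hmu]
      filter_upwards [h] with x hx
      have : f x = 0 := by simpa using hx
      simp [this]
    rw [this] at hA
    simp at hA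
  have hNr : 0 < N.toReal := ENNReal.toReal_pos hN0 hf2
  set r := Real.sqrt N.toReal with hr
  have hr2 : r ^ 2 = N.toReal := Real.sq_sqrt hNr.le
  have hfin : ∀ᵐ x, f x < ⊤ := by
    filter_upwards [ae_lt_top (hf.pow_const 2) hf2] with x hx
    by_contra h
    simp only [not_lt, top_le_iff] at h
    simp [h] at hx
  have hm2 : Measurable fun x => f x ^ 2 := hf.pow_const 2
  set u : E2 → ℝ := fun x => (f x).toReal / r with hu
  have hum : Measurable u := hf.ennreal_toReal.div_const r
  have hu2 : (fun x => u x ^ 2) = fun x => (f x ^ 2).toReal / N.toReal := by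
    ext x
    simp only [hu, div_pow, hr2, ENNReal.toReal_pow]
  have hui : Integrable fun x => u x ^ 2 := by
    rw [hu2]
    exact (integrable_toReal_of_lintegral_ne_top hm2.aemeasurable hf2).div_const _
  have hu1 : ∫ x, u x ^ 2 = 1 := by
    rw [hu2, integral_div, integral_toReal hm2.aemeasurable (ae_lt_top hm2 hf2), ← hN, div_self hNr.ne']
  have hCm' : Measurable fun p : E2 × SL2 => f p.1 * f (lact p.2 p.1) :=
    (hf.comp measurable_fst).mul (hf.comp lact_joint')
  have hCm : Measurable fun M : SL2 => ∫⁻ x, f x * f (lact M x) := hCm'.lintegral_prod_left'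
  have hCfin : ∀ M : SL2, ∫⁻ x, f x * f (lact M x) ≠ ⊤ := by
    intro M
    have : ∫⁻ x, f x * f (lact M x) ≤ N + N := by
      calc ∫⁻ x, f x * f (lact M x) ≤ ∫⁻ x, (1 * f x ^ 2 + 1⁻¹ * f (lact M x) ^ 2) :=
            lintegral_mono fun x => ennreal_amgm _ _ 1 (by simp) (by simp)
        _ = N + N := by
            simp only [inv_one, one_mul]
            rw [lintegral_add_left hm2]
            congr 1
            exact (lact_mp M).lintegral_comp hm2
    exact ne_top_of_le_ne_top (by simp [hf2]) this
  have hc : ∀ M : SL2, ∫ x, u x * u (lact M x) = (∫⁻ x, f x * f (lact M x)).toReal / N.toReal := by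
    intro M
    have hmm : Measurable fun x => f x * f (lact M x) := hf.mul (hf.comp (lact_meas M))
    have e : (fun x => u x * u (lact M x)) = fun x => (f x * f (lact M x)).toReal / N.toReal := by
      ext x
      simp only [hu, ENNReal.toReal_mul, ← hr2]
      ring
    rw [e, integral_div, integral_toReal hmm.aemeasurable (ae_lt_top hmm (hCfin M))]
  have hcm : Measurable (fun M : SL2 => ∫ x, u x * u (lact M x)) := by
    simp only [hc]
    exact hCm.ennreal_toReal.div_const _
  refine ⟨u, hum, hui, hu1, hcm, ?_⟩
  have hle := corr_le_one u hum hui hu1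
  have hcpos : ∀ M : SL2, 0 ≤ ∫ x, u x * u (lact M x) := by
    intro M; rw [hc]; positivity
  have hci : Integrable (fun M : SL2 => ∫ x, u x * u (lact M x)) ν := by
    refine Integrable.mono' (integrable_const 1) hcm.aestronglyMeasurable
      (Eventually.of_forall fun M => ?_)
    rw [Real.norm_of_nonneg (hcpos M)]; exact hle M
  have hci1 : Integrable (fun M : SL2 => 1 - ∫ x, u x * u (lact M x)) ν := (integrable_const 1).sub hci
  rw [← ofReal_integral_eq_lintegral_ofReal hci1
    (Eventually.of_forall fun M => sub_nonneg.2 (hle M))]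
  refine ENNReal.ofReal_le_ofReal ?_
  rw [integral_sub (integrable_const 1) hci]
  simp only [integral_const, probReal_univ, smul_eq_mul, mul_one]
  have hswap : ∫⁻ M, (∫⁻ x, f x * f (lact M x)) ∂ν = ∫⁻ x, f x * avg ν f x := by
    rw [← lintegral_lintegral_swap hCm'.aemeasurable]
    refine lintegral_congr fun x => ?_
    have h5 : Measurable fun M : SL2 => f (lact M x) := hf.comp (lact_left x)
    rw [lintegral_const_mul _ h5]
    rfl
  have hint : ∫ M, (∫ x, u x * u (lact M x)) ∂ν = (∫⁻ x, f x * avg ν f x).toReal / N.toReal := by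
    simp only [hc]
    rw [integral_div, integral_toReal hCm.aemeasurable
      (Eventually.of_forall fun M => (hCfin M).lt_top), hswap]
  rw [hint]
  have hAfin : ∫⁻ x, f x * avg ν f x ≠ ⊤ := by
    rw [← hswap]
    have : ∫⁻ M, (∫⁻ x, f x * f (lact M x)) ∂ν ≠ ⊤ := by
      have h5 : ∀ M, (∫⁻ x, f x * f (lact M x)) ≤ N := by
        intro M
        have := hle M
        rw [hc, div_le_one hNr] at this
        exact (ENNReal.toReal_le_toReal (hCfin M) hf2).1 this
      refine ne_top_of_le_ne_top hf2 ((lintegral_mono h5).trans ?_)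
      simp
    exact this
  have h6 := (ENNReal.toReal_lt_toReal (ENNReal.mul_ne_top (by simp) hf2) hAfin).2 hA
  rw [ENNReal.toReal_mul, ENNReal.coe_toReal, ← lt_div_iff₀ hNr] at h6
  linarith

/-- failure of the spectral gap produces almost invariant functions -/
lemma seq_u (hgap : ¬ ∃ q : NNReal, q < 1 ∧ ∀ f : E2 → ENNReal, Measurable f → ∫⁻ x, f x ^ 2 ≠ ⊤ →
      ∫⁻ x, f x * avg ν f x ≤ q * ∫⁻ x, f x ^ 2) :
    ∃ u : ℕ → E2 → ℝ, (∀ k, Measurable (u k)) ∧ (∀ k, Integrable (fun x => u k x ^ 2)) ∧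
      (∀ k, ∫ x, u k x ^ 2 = 1) ∧ ∀ᵐ M ∂ν, Tendsto
        (fun k : ℕ => (1 - ∫ x, u k x * u k (lact M x)) / (1 / 2) ^ k) atTop (nhds 0) := by
  push Not at hgap
  have hk : ∀ k : ℕ, ∃ u : E2 → ℝ, Measurable u ∧ Integrable (fun x => u x ^ 2) ∧ ∫ x, u x ^ 2 = 1 ∧
      Measurable (fun M : SL2 => ∫ x, u x * u (lact M x)) ∧
      ∫⁻ M, ENNReal.ofReal (1 - ∫ x, u x * u (lact M x)) ∂ν ≤ ENNReal.ofReal ((1 / 4) ^ k) := by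
    intro k
    have hp : (0 : ℝ) < (1 / 4) ^ k := by positivity
    have hp1 : ((1 : ℝ) / 4) ^ k ≤ 1 := pow_le_one₀ (by norm_num) (by norm_num)
    let q : NNReal := ⟨1 - (1 / 4) ^ k, by linarith⟩
    have hq : q < 1 := by
      rw [← NNReal.coe_lt_coe]; change 1 - ((1 : ℝ) / 4) ^ k < 1; linarith
    obtain ⟨f, hf, hf2, hA⟩ := hgap q hq
    obtain ⟨u, a, b, c, d, e⟩ := one_u ν q f hf hf2 hA
    refine ⟨u, a, b, c, d, e.trans (le_of_eq ?_)⟩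
    congr 1
    change 1 - (1 - ((1 : ℝ) / 4) ^ k) = _
    ring
  choose u hu1 hu2 hu3 hu4 hu5 using hk
  refine ⟨u, hu1, hu2, hu3, ?_⟩
  set D : ℕ → SL2 → ENNReal := fun k M =>
    ENNReal.ofReal ((1 - ∫ x, u k x * u k (lact M x)) / (1 / 2) ^ k) with hD
  have hDm : ∀ k, Measurable (D k) := fun k =>
    ((measurable_const.sub (hu4 k)).div_const _).ennreal_ofReal
  have hDle : ∀ k, ∫⁻ M, D k M ∂ν ≤ ENNReal.ofReal ((1 / 2) ^ k) := by
    intro k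
    have e : ∀ M, D k M = ENNReal.ofReal (2 ^ k) * ENNReal.ofReal (1 - ∫ x, u k x * u k (lact M x)) := by
      intro M
      rw [hD, ← ENNReal.ofReal_mul (by positivity)]
      simp only
      congr 1
      rw [div_eq_mul_inv, mul_comm]
      congr 1
      simp
    simp only [e]
    have hmk : Measurable fun M : SL2 => 1 - ∫ x, u k x * u k (lact M x) :=
      measurable_const.sub (hu4 k)
    rw [lintegral_const_mul _ hmk.ennreal_ofReal]
    refine (mul_le_mul_right (hu5 k) _).trans (le_of_eq ?_)
    rw [← ENNReal.ofReal_mul (by positivity), ← mul_pow]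
    norm_num
  have hsum : ∫⁻ M, ∑' k, D k M ∂ν ≠ ⊤ := by
    rw [lintegral_tsum fun k => (hDm k).aemeasurable]
    refine ne_top_of_le_ne_top ?_ (ENNReal.tsum_le_tsum hDle)
    have hs : Summable fun k : ℕ => ((1 : ℝ) / 2) ^ k := summable_geometric_two
    exact hs.tsum_ofReal_ne_top
  have hfin := ae_lt_top (Measurable.tsum hDm) hsum
  filter_upwards [hfin] with M hM
  have h7 := ENNReal.tendsto_atTop_zero_of_tsum_ne_top hM.ne
  have h8 := (ENNReal.tendsto_toReal (by simp : (0 : ENNReal) ≠ ⊤)).comp h7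
  simp only [ENNReal.toReal_zero] at h8
  refine h8.congr fun k => ?_
  simp only [Function.comp, hD]
  rw [ENNReal.toReal_ofReal]
  exact div_nonneg (sub_nonneg.2 (corr_le_one (u k) (hu1 k) (hu2 k) (hu3 k) M)) (by positivity)

end

/-- unit circle -/
abbrev S1 := Metric.sphere (0 : E2) 1

/-- base point -/
def bpt : S1 := ⟨EuclideanSpace.single 0 1, by simp⟩

open Classical in
/-- normalisation -/
def nz (x : E2) : S1 := if h : x = 0 then bpt else ⟨‖x‖⁻¹ • x, by
  simp [norm_smul, h]⟩

lemma nz_coe (x : E2) (h : x ≠ 0) : (nz x : E2) = ‖x‖⁻¹ • x := by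
  simp [nz, h]

lemma nz_smul (x : E2) (h : x ≠ 0) (c : ℝ) (hc : 0 < c) : nz (c • x) = nz x := by
  apply Subtype.ext
  rw [nz_coe _ h, nz_coe _ (smul_ne_zero hc.ne' h), norm_smul, Real.norm_of_nonneg hc.le, smul_smul]
  congr 1
  field_simp

lemma S1_ne (x : S1) : (x : E2) ≠ 0 := by
  intro h
  have := x.2
  simp [h] at this

lemma nz_self (x : S1) : nz (x : E2) = x := by
  apply Subtype.ext
  rw [nz_coe _ (S1_ne x)]
  have : ‖(x : E2)‖ = 1 := by simpa using x.2
  simp [this]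

lemma nz_contOn : ContinuousOn nz {x | x ≠ 0} := by
  rw [continuousOn_iff_continuous_domRestrict]
  refine Continuous.subtype_mk (p := fun x => x ∈ Metric.sphere (0 : E2) 1)
    (f := fun x : {x : E2 | x ≠ 0} => (nz (x : E2) : E2)) ?_ (fun x => (nz (x : E2)).2)
  have : (fun x : {x : E2 | x ≠ 0} => (nz (x : E2) : E2)) = fun x : {x : E2 | x ≠ 0} => ‖(x : E2)‖⁻¹ • (x : E2) := by
    ext1 x; exact nz_coe _ x.2
  rw [this]
  exact (continuous_subtype_val.norm.inv₀ fun x => norm_ne_zero_iff.2 x.2).smul continuous_subtype_val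

lemma nz_meas : Measurable nz := by
  refine Measurable.subtype_mk (f := fun x : E2 => (nz x : E2)) ?_ (h := fun x => (nz x).2)
  have : (fun x : E2 => (nz x : E2)) = ({0} : Set E2).piecewise (fun _ => (bpt : E2)) (fun x => ‖x‖⁻¹ • x) := by
    ext1 x
    by_cases h : x = 0
    · simp [h, nz]
    · rw [nz_coe _ h]; simp [h]
  rw [this]
  exact Measurable.piecewise (measurableSet_singleton 0) measurable_const
    (measurable_norm.inv.smul measurable_id)

lemma lact_ne (M : SL2) (x : E2) (h : x ≠ 0) : lact M x ≠ 0 := by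
  intro h0
  apply h
  apply sl2_inj M
  change lact M x = lact M 0
  rw [h0, map_zero]

/-- action on the circle -/
def sact (M : SL2) (x : S1) : S1 := nz (lact M x)

lemma nz_lact (M : SL2) (x : E2) (h : x ≠ 0) : nz (lact M x) = sact M (nz x) := by
  rw [sact, nz_coe _ h, map_smul, nz_smul _ (lact_ne M x h)]
  exact inv_pos.2 (norm_pos_iff.2 h)

lemma sact_mul (M N : SL2) (x : S1) : sact (M * N) x = sact M (sact N x) := by
  rw [sact, lact_mul_apply, nz_lact _ _ (lact_ne N x (S1_ne x))]
  rfl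

lemma sact_one (x : S1) : sact 1 x = x := by
  rw [sact, lact_one_apply, nz_self]

lemma sact_joint : Continuous (fun p : SL2 × S1 => sact p.1 p.2) := by
  have h1 : Continuous (fun p : SL2 × S1 => lact p.1 (p.2 : E2)) :=
    (lact_continuous.comp continuous_fst).clm_apply (continuous_subtype_val.comp continuous_snd)
  exact nz_contOn.comp_continuous h1 fun p => lact_ne p.1 _ (S1_ne p.2)

lemma sact_cont (M : SL2) : Continuous (sact M) :=
  nz_contOn.comp_continuous ((lact M).continuous.comp continuous_subtype_val)
    fun x => lact_ne M _ (S1_ne x)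

lemma sact_cont_left (x : S1) : Continuous (fun M => sact M x) :=
  nz_contOn.comp_continuous (lact_continuous.clm_apply continuous_const)
    fun M => lact_ne M _ (S1_ne x)

/-- stabiliser of a measure -/
def Hstab (m : Measure S1) : Subgroup SL2 where
  carrier := {M | m.map (sact M) = m}
  one_mem' := by
    have : sact 1 = id := funext sact_one
    simp [this]
  mul_mem' := by
    intro M N hM hN
    have e : sact (M * N) = sact M ∘ sact N := funext (sact_mul M N)
    change m.map (sact (M * N)) = m
    change m.map (sact M) = m at hM
    change m.map (sact N) = m at hN
    rw [e, ← Measure.map_map (sact_cont M).measurable (sact_cont N).measurable, hN, hM]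
  inv_mem' := by
    intro M hM
    change m.map (sact M⁻¹) = m
    change m.map (sact M) = m at hM
    have e : sact M⁻¹ ∘ sact M = id := by
      ext1 x
      simp [← sact_mul, sact_one]
    conv_lhs => rw [← hM]
    rw [Measure.map_map (sact_cont _).measurable (sact_cont M).measurable, e, Measure.map_id]

lemma mem_Hstab (m : Measure S1) [IsProbabilityMeasure m] (M : SL2) :
    M ∈ Hstab m ↔ ∀ φ : BoundedContinuousFunction S1 ℝ, ∫ x, φ (sact M x) ∂m = ∫ x, φ x ∂m := by
  have hm : ∀ φ : BoundedContinuousFunction S1 ℝ, ∫ x, φ x ∂(m.map (sact M)) = ∫ x, φ (sact M x) ∂m :=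
    fun φ => integral_map (sact_cont M).measurable.aemeasurable φ.continuous.aestronglyMeasurable
  change m.map (sact M) = m ↔ _
  constructor
  · intro h φ
    rw [← hm, h]
  · intro h
    have : IsProbabilityMeasure (m.map (sact M)) :=
      Measure.isProbabilityMeasure_map (sact_cont M).measurable.aemeasurable
    refine ext_of_forall_integral_eq_of_IsFiniteMeasure fun φ => ?_
    rw [hm, h]

lemma Hstab_closed (m : Measure S1) [IsProbabilityMeasure m] : IsClosed (Hstab m : Set SL2) := by
  have : (Hstab m : Set SL2) = ⋂ φ : BoundedContinuousFunction S1 ℝ,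
      {M | ∫ x, φ (sact M x) ∂m = ∫ x, φ x ∂m} := by
    ext M
    simp only [SetLike.mem_coe, mem_Hstab, Set.mem_iInter, Set.mem_ofPred_eq]
  rw [this]
  refine isClosed_iInter fun φ => isClosed_eq ?_ continuous_const
  refine continuous_of_dominated (bound := fun _ => ‖φ‖) ?_ ?_ (integrable_const _) ?_
  · exact fun M => (φ.continuous.comp (sact_cont M)).aestronglyMeasurable
  · exact fun M => Eventually.of_forall fun x => φ.norm_coe_le_norm _
  · exact Eventually.of_forall fun x => φ.continuous.comp (sact_cont_left x)

lemma Gnu_le (ν : Measure SL2) (m : Measure S1) [IsProbabilityMeasure m]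
    (h : ∀ᵐ M ∂ν, M ∈ Hstab m) : Gnu ν ⊆ Hstab m := by
  refine closure_minimal ?_ (Hstab_closed m)
  refine (Subgroup.closure_le (Hstab m)).2 fun M hM => ?_
  by_contra hn
  exact hM _ ((Hstab_closed m).isOpen_compl.mem_nhds hn) h

/-- the probability measures attached to an L² function -/
def mm (u : E2 → ℝ) : Measure S1 :=
  (volume.withDensity fun x => ENNReal.ofReal (u x ^ 2)).map nz

lemma mm_prob (u : E2 → ℝ) (hi : Integrable (fun x => u x ^ 2)) (h1 : ∫ x, u x ^ 2 = 1) :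
    IsProbabilityMeasure (mm u) := by
  have : IsProbabilityMeasure (volume.withDensity fun x => ENNReal.ofReal (u x ^ 2)) := by
    constructor
    rw [withDensity_apply _ MeasurableSet.univ, Measure.restrict_univ,
      ← ofReal_integral_eq_lintegral_ofReal hi (Eventually.of_forall fun x => sq_nonneg _), h1]
    simp
  exact Measure.isProbabilityMeasure_map nz_meas.aemeasurable

lemma mm_integral (u : E2 → ℝ) (hu : Measurable u) (g : S1 → ℝ) (hg : Measurable g) :
    ∫ y, g y ∂(mm u) = ∫ x, g (nz x) * u x ^ 2 := by
  rw [mm, integral_map nz_meas.aemeasurable hg.aestronglyMeasurable,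
    integral_withDensity_eq_integral_toReal_smul (hu.pow_const 2).ennreal_ofReal
      (Eventually.of_forall fun x => ENNReal.ofReal_lt_top)]
  refine integral_congr_ae (Eventually.of_forall fun x => ?_)
  simp only [smul_eq_mul]
  rw [ENNReal.toReal_ofReal (sq_nonneg _), mul_comm]

lemma exists_inv (ν : Measure SL2) [IsProbabilityMeasure ν]
    (hgap : ¬ ∃ q : NNReal, q < 1 ∧ ∀ f : E2 → ENNReal, Measurable f → ∫⁻ x, f x ^ 2 ≠ ⊤ →
      ∫⁻ x, f x * avg ν f x ≤ q * ∫⁻ x, f x ^ 2) :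
    ∃ m : Measure S1, IsProbabilityMeasure m ∧ Gnu ν ⊆ Hstab m := by
  obtain ⟨u, hu1, hu2, hu3, hu4⟩ := seq_u ν hgap
  let mk : ℕ → ProbabilityMeasure S1 := fun k => ⟨mm (u k), mm_prob (u k) (hu2 k) (hu3 k)⟩
  let U : Ultrafilter ℕ := hyperfilter ℕ
  obtain ⟨m, -, hm⟩ := isCompact_univ.ultrafilter_le_nhds (U.map mk) (by simp)
  have hm' : Tendsto mk (U : Filter ℕ) (nhds m) := hm
  rw [ProbabilityMeasure.tendsto_iff_forall_integral_tendsto] at hm'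
  refine ⟨m, inferInstance, Gnu_le ν m ?_⟩
  filter_upwards [hu4] with M hM
  rw [mem_Hstab]
  intro φ
  let φM : BoundedContinuousFunction S1 ℝ := φ.compContinuous ⟨sact M, sact_cont M⟩
  have t1 := hm' φ
  have t2 := hm' φM
  have t3 : Tendsto (fun k => (∫ x, φM x ∂(mm (u k))) - ∫ x, φ x ∂(mm (u k))) atTop (nhds 0) := by
    have hb : Tendsto (fun k : ℕ => ‖φ‖ * ((1 - ∫ x, u k x * u k (lact M x)) / (1 / 2) ^ k
        + 2 * (1 / 2) ^ k)) atTop (nhds (‖φ‖ * (0 + 2 * 0))) :=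
      (hM.add ((tendsto_pow_atTop_nhds_zero_of_lt_one (by norm_num) (by norm_num)).const_mul 2)).const_mul _
    simp only [mul_zero, add_zero] at hb
    refine squeeze_zero_norm (fun k => ?_) hb
    rw [mm_integral _ (hu1 k) _ φM.continuous.measurable, mm_integral _ (hu1 k) _ φ.continuous.measurable]
    have hcd := corr_diff (u k) (hu1 k) (hu2 k) (hu3 k) M (fun x => φ (nz x))
      (φ.continuous.measurable.comp nz_meas) ‖φ‖ (fun x => φ.norm_coe_le_norm _) ((1 / 2) ^ k) (by positivity)
    have e : ∫ x, φM (nz x) * u k x ^ 2 = ∫ x, φ (nz (lact M x)) * u k x ^ 2 := by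
      refine integral_congr_ae ?_
      have h0 : ∀ᵐ x : E2, x ≠ 0 := by
        rw [ae_iff]; simp
      filter_upwards [h0] with x hx
      rw [nz_lact M x hx]
      rfl
    rw [e]
    exact hcd
  have t4 := t3.mono_left (Nat.hyperfilter_le_atTop)
  have t5 := tendsto_nhds_unique (t2.sub t1) t4
  exact sub_eq_zero.1 t5

lemma entry_le_nrm (M : SL2) (i j : Fin 2) : |M i j| ≤ nrm M := by
  have h1 : ‖lact M (EuclideanSpace.single j 1)‖ ≤ nrm M := by
    have := (lact M).le_opNorm (EuclideanSpace.single j 1)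
    simpa [nrm_eq] using this
  refine le_trans ?_ h1
  have h2 := PiLp.norm_apply_le (lact M (EuclideanSpace.single j 1)) i
  have h3 : lact M (EuclideanSpace.single j 1) i = M i j := by
    rw [lact_coord]
    fin_cases j <;> simp
  rwa [h3, Real.norm_eq_abs] at h2

lemma sl2_closedEmb : Topology.IsClosedEmbedding (fun M : SL2 => (M : Matrix (Fin 2) (Fin 2) ℝ)) := by
  have hc : IsClosed {A : Matrix (Fin 2) (Fin 2) ℝ | A.det = 1} :=
    isClosed_eq (Continuous.matrix_det continuous_id) continuous_const
  exact hc.isClosedEmbedding_subtypeVal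

lemma nrm_unbdd (ν : Measure SL2) (hnc : ¬ IsCompact (Gnu ν)) (R : ℝ) : ∃ M ∈ Gnu ν, R < nrm M := by
  by_contra hcon
  push Not at hcon
  apply hnc
  have hK : IsCompact {A : Matrix (Fin 2) (Fin 2) ℝ | ∀ i j, A i j ∈ Set.Icc (-R) R} := by
    have := isCompact_univ_pi (fun _ : Fin 2 => isCompact_univ_pi (fun _ : Fin 2 => isCompact_Icc (a := -R) (b := R)))
    have e : {A : Matrix (Fin 2) (Fin 2) ℝ | ∀ i j, A i j ∈ Set.Icc (-R) R} =
        Set.univ.pi (fun _ : Fin 2 => Set.univ.pi (fun _ : Fin 2 => Set.Icc (-R) R)) := by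
      apply Set.ext
      intro A
      constructor
      · intro h i _ j _
        exact h i j
      · intro h i j
        exact h i trivial j trivial
    rw [e]
    exact this
  refine (sl2_closedEmb.isCompact_preimage hK).of_isClosed_subset isClosed_closure ?_
  intro M hM i j
  have := (entry_le_nrm M i j).trans (hcon M hM)
  exact abs_le.1 this

/-- the area form -/
def om (x y : E2) : ℝ := x 0 * y 1 - x 1 * y 0

lemma om_cont (v : E2) : Continuous fun x : E2 => om x v := by
  unfold om; fun_prop

lemma om_cont2 : Continuous fun p : E2 × E2 => om p.1 p.2 := by
  unfold om; fun_prop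

lemma om_lact (M : SL2) (x y : E2) : om (lact M x) (lact M y) = om x y := by
  have hd := M.prop
  rw [Matrix.det_fin_two] at hd
  simp only [om, lact_coord]
  linear_combination (x 0 * y 1 - x 1 * y 0) * hd

lemma om_smul (a b : ℝ) (x y : E2) : om (a • x) (b • y) = a * b * om x y := by
  simp [om]; ring

lemma om_id (x w z : E2) : om x w • z = om z w • x + om x z • w := by
  ext i
  fin_cases i <;> simp [om] <;> ring

lemma om_zero_iff (y v : E2) (hv : v ≠ 0) : om y v = 0 ↔ ∃ a : ℝ, a • v = y := by
  constructor
  · intro h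
    unfold om at h
    by_cases h0 : v 0 = 0
    · have h1 : v 1 ≠ 0 := by
        intro h1; apply hv; ext i; fin_cases i <;> simp [h0, h1]
      have hy : y 0 = 0 := by
        rw [h0] at h; simpa [h1] using h
      refine ⟨y 1 / v 1, ?_⟩
      ext i; fin_cases i
      · simp [h0, hy]
      · simp [h1]
    · refine ⟨y 0 / v 0, ?_⟩
      ext i; fin_cases i
      · simp [h0]
      · simp only [Fin.mk_one, PiLp.smul_apply, smul_eq_mul]
        field_simp
        linarith
  · rintro ⟨a, rfl⟩
    simp [om]; ring

lemma exists_atom (ν : Measure SL2) (hnc : ¬ IsCompact (Gnu ν)) (m : Measure S1)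
    [IsProbabilityMeasure m] (hG : Gnu ν ⊆ Hstab m) :
    ∃ v : E2, v ≠ 0 ∧ m {y : S1 | om y v = 0} ≠ 0 := by
  choose g hg hgn using fun k : ℕ => nrm_unbdd ν hnc k
  let A : ℕ → E2 →L[ℝ] E2 := fun k => (nrm (g k))⁻¹ • lact (g k)
  have hA1 : ∀ k, ‖A k‖ = 1 := by
    intro k
    rw [norm_smul, ← nrm_eq, Real.norm_of_nonneg (inv_pos.2 (nrm_pos _)).le,
      inv_mul_cancel₀ (nrm_pos _).ne']
  have : ProperSpace (E2 →L[ℝ] E2) := FiniteDimensional.proper ℝ _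
  obtain ⟨h, -, σ, hσ, hlim⟩ := (isCompact_closedBall (0 : E2 →L[ℝ] E2) 1).tendsto_subseq
    (x := A) (fun k => by simp [hA1])
  have hh1 : ‖h‖ = 1 := by
    refine tendsto_nhds_unique hlim.norm ?_
    simp only [Function.comp, hA1]
    exact tendsto_const_nhds
  have hpt : ∀ x, Tendsto (fun k => A (σ k) x) atTop (nhds (h x)) := fun x =>
    ((ContinuousLinearMap.apply ℝ E2 x).continuous.tendsto h).comp hlim
  have hom : ∀ x y, om (h x) (h y) = 0 := by
    intro x y
    have t1 : Tendsto (fun k => om (A (σ k) x) (A (σ k) y)) atTop (nhds (om (h x) (h y))) :=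
      (om_cont2.tendsto (h x, h y)).comp ((hpt x).prodMk_nhds (hpt y))
    refine tendsto_nhds_unique t1 ?_
    have e : ∀ k, om (A k x) (A k y) = (nrm (g k))⁻¹ * (nrm (g k))⁻¹ * om x y := by
      intro k
      change om ((nrm (g k))⁻¹ • lact (g k) x) ((nrm (g k))⁻¹ • lact (g k) y) = _
      rw [om_smul, om_lact]
    simp only [e]
    have t2 : Tendsto (fun k => (nrm (g k))) atTop atTop :=
      tendsto_atTop_mono (fun k => (hgn k).le) tendsto_natCast_atTop_atTop
    have t3 := (tendsto_inv_atTop_zero.comp t2).comp hσ.tendsto_atTop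
    simpa using (t3.mul t3).mul_const (om x y)
  have hne : h ≠ 0 := by
    intro h0; rw [h0] at hh1; simp at hh1
  obtain ⟨p, hp⟩ : ∃ p, h p ≠ 0 := by
    by_contra hc; push Not at hc
    exact hne (ContinuousLinearMap.ext hc)
  obtain ⟨w, hw, hker⟩ : ∃ w : E2, w ≠ 0 ∧ ∀ x, h x = 0 → om x w = 0 := by
    by_cases hk : ∃ w, w ≠ 0 ∧ h w = 0
    · obtain ⟨w, hw, hhw⟩ := hk
      refine ⟨w, hw, fun x hx => ?_⟩
      by_contra hxw
      have := congrArg h (om_id x w p)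
      rw [map_add, map_smul, map_smul, map_smul, hx, hhw] at this
      simp only [smul_zero, add_zero] at this
      exact (smul_ne_zero hxw hp) this
    · push Not at hk
      refine ⟨p, ?_, fun x hx => ?_⟩
      · rintro rfl; simp at hp
      · have : x = 0 := by
          by_contra hx0; exact hk x hx0 hx
        simp [this, om]
  by_cases hmw : m {y : S1 | om y w = 0} = 0
  swap
  · exact ⟨w, hw, hmw⟩
  refine ⟨h p, hp, ?_⟩
  let φ : BoundedContinuousFunction S1 ℝ := BoundedContinuousFunction.mkOfCompact
    ⟨fun y => om y (h p) ^ 2, ((om_cont (h p)).comp continuous_subtype_val).pow 2⟩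
  have hφ : ∀ y, φ y = om y (h p) ^ 2 := fun y => rfl
  have hint : ∀ k, ∫ y, φ (sact (g (σ k)) y) ∂m = ∫ y, φ y ∂m := fun k =>
    (mem_Hstab m _).1 (hG (hg _)) φ
  have hae : ∀ᵐ y ∂m, Tendsto (fun k => φ (sact (g (σ k)) y)) atTop (nhds 0) := by
    have : ∀ᵐ y : S1 ∂m, om y w ≠ 0 := by
      rw [ae_iff]; simpa using hmw
    filter_upwards [this] with y hy
    have hhy : h y ≠ 0 := fun h0 => hy (hker _ h0)
    have e : ∀ k, sact (g (σ k)) y = nz (A (σ k) y) := by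
      intro k
      change _ = nz ((nrm (g (σ k)))⁻¹ • lact (g (σ k)) y)
      rw [nz_smul _ (lact_ne _ _ (S1_ne y)) _ (inv_pos.2 (nrm_pos _))]
      rfl
    simp only [e]
    have hopen : {x : E2 | x ≠ 0} ∈ nhds (h y) := isOpen_ne.mem_nhds hhy
    have t1 : Tendsto (fun k => nz (A (σ k) y)) atTop (nhds (nz (h y))) :=
      (nz_contOn.continuousAt hopen).tendsto.comp (hpt y)
    have t2 := (φ.continuous.tendsto _).comp t1
    have e2 : φ (nz (h y)) = 0 := by
      rw [hφ, nz_coe _ hhy]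
      have := om_smul (‖h y‖⁻¹) 1 (h y) (h p)
      rw [one_smul] at this
      rw [this, hom]; simp
    rw [e2] at t2
    exact t2
  have t3 : Tendsto (fun k => ∫ y, φ (sact (g (σ k)) y) ∂m) atTop (nhds (∫ y : S1, (0 : ℝ) ∂m)) := by
    refine tendsto_integral_of_dominated_convergence (fun _ => ‖φ‖) ?_ (integrable_const _) ?_ hae
    · exact fun k => (φ.continuous.comp (sact_cont _)).aestronglyMeasurable
    · exact fun k => Eventually.of_forall fun y => φ.norm_coe_le_norm _
  simp only [hint, integral_zero] at t3
  have h0 : ∫ y, φ y ∂m = 0 := tendsto_nhds_unique tendsto_const_nhds t3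
  have hφi : Integrable φ m := φ.integrable m
  rw [integral_eq_zero_iff_of_nonneg (fun y => by rw [hφ]; exact sq_nonneg _) hφi] at h0
  intro hz
  have hne : ∀ᵐ y : S1 ∂m, om y (h p) ≠ 0 := by
    rw [ae_iff]; simpa using hz
  have hF : ∀ᵐ y : S1 ∂m, False := by
    filter_upwards [h0, hne] with y h1 h2
    rw [hφ] at h1
    exact h2 (by simpa using h1)
  simp at hF
  exact IsProbabilityMeasure.ne_zero m hF

/-- class in the projective line -/
def cls (y : S1) : P1 := Projectivization.mk ℝ (y : E2) (S1_ne y)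

lemma cls_fiber (v : E2) (hv : v ≠ 0) : cls ⁻¹' {Projectivization.mk ℝ v hv} = {y : S1 | om y v = 0} := by
  ext y
  simp only [Set.mem_preimage, Set.mem_singleton_iff, Set.mem_ofPred_eq, cls]
  rw [Projectivization.mk_eq_mk_iff', om_zero_iff _ _ hv]

lemma cls_meas (ℓ : P1) : MeasurableSet (cls ⁻¹' {ℓ}) := by
  induction ℓ using Projectivization.ind with
  | h v hv =>
    rw [cls_fiber]
    exact (isClosed_eq ((om_cont v).comp continuous_subtype_val) continuous_const).measurableSet

lemma projAct_mk (M : SL2) (v : E2) (hv : v ≠ 0) :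
    projAct M (Projectivization.mk ℝ v hv) = Projectivization.mk ℝ (lact M v) (lact_ne M v hv) := rfl

lemma cls_sact (M : SL2) (y : S1) : cls (sact M y) = projAct M (cls y) := by
  rw [cls, cls, projAct_mk, Projectivization.mk_eq_mk_iff']
  exact ⟨‖lact M y‖⁻¹, (nz_coe _ (lact_ne M _ (S1_ne y))).symm⟩

lemma projAct_inj (M : SL2) : Function.Injective (projAct M) :=
  Projectivization.map_injective _ (sl2_inj M)

lemma projAct_inv (M : SL2) (ℓ : P1) : projAct M (projAct M⁻¹ ℓ) = ℓ := by
  induction ℓ using Projectivization.ind with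
  | h v hv =>
    rw [projAct_mk, projAct_mk]
    congr 1
    rw [← lact_mul_apply, mul_inv_cancel, lact_one_apply]

lemma mass_inv (m : Measure S1) (M : SL2) (hM : M ∈ Hstab m) (ℓ : P1) :
    m (cls ⁻¹' {projAct M ℓ}) = m (cls ⁻¹' {ℓ}) := by
  have h : m.map (sact M) = m := hM
  conv_lhs => rw [← h]
  rw [Measure.map_apply (sact_cont M).measurable (cls_meas _)]
  congr 1
  ext y
  simp only [Set.mem_preimage, Set.mem_singleton_iff, cls_sact]
  exact (projAct_inj M).eq_iff

lemma gap (ν : Measure SL2) [IsProbabilityMeasure ν] (hnc : ¬ IsCompact (Gnu ν))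
    (hinv : ¬ ∃ L : Set P1, L.Finite ∧ L.Nonempty ∧ ∀ M ∈ Gnu ν, projAct M '' L = L) :
    ∃ q : NNReal, q < 1 ∧ ∀ f : E2 → ENNReal, Measurable f → ∫⁻ x, f x ^ 2 ≠ ⊤ →
      ∫⁻ x, f x * avg ν f x ≤ q * ∫⁻ x, f x ^ 2 := by
  by_contra hgap
  obtain ⟨m, hm, hG⟩ := exists_inv ν hgap
  obtain ⟨v, hv, hmv⟩ := exists_atom ν hnc m hG
  rw [← cls_fiber v hv] at hmv
  apply hinv
  set c := m (cls ⁻¹' {Projectivization.mk ℝ v hv}) with hc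
  refine ⟨{ℓ | c ≤ m (cls ⁻¹' {ℓ})}, ?_, ⟨Projectivization.mk ℝ v hv, ?_⟩, ?_⟩
  · refine Measure.finite_const_le_meas_of_disjoint_iUnion m (pos_iff_ne_zero.2 hmv) cls_meas ?_
      (measure_ne_top _ _)
    intro a b hab
    exact Disjoint.preimage _ (by simpa using hab)
  · change c ≤ _
    exact le_rfl
  · intro M hM
    ext ℓ
    constructor
    · rintro ⟨ℓ', h1, rfl⟩
      change c ≤ _
      rw [mass_inv m M (hG hM)]
      exact h1
    · intro h1
      refine ⟨projAct M⁻¹ ℓ, ?_, projAct_inv M ℓ⟩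
      change c ≤ _
      rw [mass_inv m M⁻¹ ((Hstab m).inv_mem (hG hM))]
      exact h1

/-- **Fürstenberg's theorem.** Let `ν` be a probability measure on `SL(2,ℝ)` with
`∫ log ‖M‖ dν(M) < ∞` and let `G_ν` be the smallest closed subgroup containing `supp ν`.
If `G_ν` is not compact and there is no finite non-empty subset `L ⊆ ℙ¹(ℝ)` with `M·L = L`
for all `M ∈ G_ν`, then there is `γ > 0` such that for `ν^ℕ`-almost every i.i.d. sequence
`T` (the product measure `μ` being characterized by its values on cylinder sets),
`(1/n) log ‖T n ⋯ T 1‖ → γ`. -/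
theorem furstenberg
    (ν : Measure SL2) [IsProbabilityMeasure ν]
    (hlog : ∫⁻ M : SL2, ENNReal.ofReal (Real.log (opNorm (M : Matrix (Fin 2) (Fin 2) ℝ))) ∂ν
      < ⊤)
    (hnc : ¬ IsCompact (Gnu ν))
    (hinv : ¬ ∃ L : Set P1, L.Finite ∧ L.Nonempty ∧ ∀ M ∈ Gnu ν, projAct M '' L = L)
    (μ : Measure (ℕ → SL2)) [IsProbabilityMeasure μ]
    (hμ : ∀ (s : Finset ℕ) (A : ℕ → Set SL2), (∀ i, MeasurableSet (A i)) →
      μ {T | ∀ i ∈ s, T i ∈ A i} = ∏ i ∈ s, ν (A i)) :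
    ∃ γ : ℝ, 0 < γ ∧
      ∀ᵐ T ∂μ, Tendsto
        (fun n : ℕ => (1 / (n : ℝ)) * Real.log (opNorm ((Pprod T n : SL2) : Matrix (Fin 2) (Fin 2) ℝ)))
        atTop (nhds γ) := by
  obtain ⟨γ, h1, h2⟩ := furst_limit ν μ hμ hlog
  obtain ⟨q, hq, hA⟩ := gap ν hnc hinv
  refine ⟨γ, gamma_pos ν μ hμ hlog q hq hA γ h1, ?_⟩
  filter_upwards [h2] with T hT
  refine hT.congr fun n => ?_
  rw [one_div, div_eq_mul_inv, mul_comm]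
  rfl
end
end
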